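/- Let k ≥ 6 be an integer. If G is a finite simple graph with chromatic number k+1, then either some block of G is isomorphic to the complete graph K_{k+1}, or G contains k cycles of consecutive lengths. -/

import Mathlib

/-- `G` contains a cycle of length `n`. -/
def HasCycleLength {V : Type*} (G : SimpleGraph V) (n : ℕ) : Prop :=
  ∃ (u : V) (c : G.Walk u u), c.IsCycle ∧ c.length = n

/-- The induced subgraph of `G` on `S` is connected and has no cut-vertex. -/
def CutVertexFree {V : Type*} (G : SimpleGraph V) (S : Set V) : Prop :=
  (G.induce S).Connected ∧ ∀ v ∈ S, (G.induce (S \ {v})).Preconnected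

/-- A block of `G`: a maximal connected induced subgraph without a cut-vertex of itself,
described by its vertex set `S`. -/
def IsBlock {V : Type*} (G : SimpleGraph V) (S : Set V) : Prop :=
  CutVertexFree G S ∧ ∀ T : Set V, S ⊆ T → CutVertexFree G T → T = S

namespace ConsecutiveCycles

open Set

variable {V : Type*}

/-- The exits of a set `Q ⊆ Z`: its outside neighbours in `Z`, together with the two terminals
that stand for `A` and `B`. -/
def Exit (G : SimpleGraph V) (Z A B Q : Set V) : V ⊕ Bool → Prop
  | .inl w => w ∈ Z ∧ w ∉ Q ∧ ∃ q ∈ Q, G.Adj q w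
  | .inr true => ∃ q ∈ Q, q ∈ A
  | .inr false => ∃ q ∈ Q, q ∈ B

/-- Every nonempty subset of `Z` has at least two exits. -/
def TwoLinked (G : SimpleGraph V) (Z A B : Set V) : Prop :=
  ∀ Q ⊆ Z, Q.Nonempty → ∀ e, ∃ e', e' ≠ e ∧ Exit G Z A B Q e'

/-- `f` is a proper colouring on `S` with colours from `P`. -/
def ColorsOn (G : SimpleGraph V) (S : Set V) (P : Finset ℕ) (f : V → ℕ) : Prop :=
  (∀ v ∈ S, f v ∈ P) ∧ ∀ u ∈ S, ∀ v ∈ S, G.Adj u v → f u ≠ f v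

/-- `Z` has a proper colouring from `P` that avoids `α` on `A` and `β` on `B`. -/
def TypedColorable (G : SimpleGraph V) (Z A B : Set V) (P : Finset ℕ) (α β : ℕ) : Prop :=
  ∃ f : V → ℕ, ColorsOn G Z P f ∧ (∀ v ∈ Z, v ∈ A → f v ≠ α) ∧ (∀ v ∈ Z, v ∈ B → f v ≠ β)

/-- `l` is the vertex list of a path in `Z` from `A` to `B`. -/
structure IsPathList (G : SimpleGraph V) (Z A B : Set V) (l : List V) : Prop where
  ne_nil : l ≠ []
  nodup : l.Nodup
  chain : l.IsChain G.Adj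
  mem : ∀ v ∈ l, v ∈ Z
  head : ∀ a ∈ l.head?, a ∈ A
  last : ∀ b ∈ l.getLast?, b ∈ B

theorem exists_rank [Finite V] {G : SimpleGraph V} {Z A B : Set V} (h : TwoLinked G Z A B) :
    ∃ r : V → ℕ, InjOn r Z ∧ ∀ v ∈ Z, v ∉ B → ∃ u ∈ Z, G.Adj v u ∧ r u < r v := by
  classical
  obtain ⟨S, hS⟩ := Set.Finite.exists_maximal (s := {S : Set V | S ⊆ Z ∧ ∃ r : V → ℕ, InjOn r S ∧
    ∀ v ∈ S, v ∉ B → ∃ u ∈ S, G.Adj v u ∧ r u < r v}) (Set.toFinite _)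
    ⟨∅, by simp⟩
  obtain ⟨⟨hSZ, r, hr, hd⟩, hmax⟩ := hS
  rcases eq_or_ne S Z with rfl | hne
  · exact ⟨r, hr, hd⟩
  exfalso
  have hQ : (Z \ S).Nonempty := Set.sdiff_nonempty.2 fun hh => hne (hSZ.antisymm hh)
  have hq : ∃ q ∈ Z \ S, q ∈ B ∨ ∃ u ∈ S, G.Adj q u := by
    obtain ⟨e, he, hx⟩ := h _ Set.sdiff_subset hQ (.inr true)
    rcases e with w | (_ | _)
    · obtain ⟨hw, hwQ, q, hq, ha⟩ := hx
      exact ⟨q, hq, Or.inr ⟨w, by simpa [hw] using hwQ, ha⟩⟩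
    · obtain ⟨q, hq, hb⟩ := hx
      exact ⟨q, hq, Or.inl hb⟩
    · exact absurd rfl he
  obtain ⟨q, ⟨hqZ, hqS⟩, hq⟩ := hq
  obtain ⟨M, hM⟩ := (Set.finite_range r).bddAbove
  have hM' : ∀ v, r v < M + 1 := fun v => Nat.lt_succ_of_le (hM ⟨v, rfl⟩)
  have hmem : insert q S ∈ {S : Set V | S ⊆ Z ∧ ∃ r : V → ℕ, InjOn r S ∧
      ∀ v ∈ S, v ∉ B → ∃ u ∈ S, G.Adj v u ∧ r u < r v} := by
    refine ⟨Set.insert_subset hqZ hSZ, Function.update r q (M + 1), ?_, ?_⟩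
    · intro u hu v hv huv
      by_cases h1 : u = q <;> by_cases h2 : v = q
      · rw [h1, h2]
      · simp only [h1, Function.update_self, Function.update_of_ne h2] at huv
        exact absurd huv.symm (hM' v).ne
      · simp only [h2, Function.update_self, Function.update_of_ne h1] at huv
        exact absurd huv (hM' u).ne
      · simp only [Function.update_of_ne h1, Function.update_of_ne h2] at huv
        exact hr (hu.resolve_left h1) (hv.resolve_left h2) huv
    · rintro v hv hvB
      by_cases h1 : v = q
      · subst h1
        obtain ⟨u, hu, ha⟩ := hq.resolve_left hvB
        refine ⟨u, Or.inr hu, ha, ?_⟩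
        simpa [Function.update_of_ne ha.ne'] using hM' u
      · obtain ⟨u, hu, ha, hlt⟩ := hd v (hv.resolve_left h1) hvB
        have : u ≠ q := fun hh => hqS (hh ▸ hu)
        exact ⟨u, Or.inr hu, ha, by simpa [Function.update_of_ne h1, Function.update_of_ne this]⟩
  exact hqS (hmax hmem (Set.subset_insert q S) (Set.mem_insert q S))

theorem exists_descending {G : SimpleGraph V} {Z B : Set V} {r : V → ℕ}
    (h : ∀ v ∈ Z, v ∉ B → ∃ u ∈ Z, G.Adj v u ∧ r u < r v) (v : V) (hv : v ∈ Z) :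
    ∃ l : List V, (v :: l).IsChain (fun a b => G.Adj a b ∧ r b < r a) ∧ (∀ u ∈ v :: l, u ∈ Z) ∧
      ∀ b ∈ (v :: l).getLast?, b ∈ B := by
  induction hn : r v using Nat.strong_induction_on generalizing v with
  | _ n ih =>
    by_cases hB : v ∈ B
    · exact ⟨[], by simp, by simpa, by simpa⟩
    · obtain ⟨u, hu, ha, hlt⟩ := h v hv hB
      obtain ⟨l, h1, h2, h3⟩ := ih _ (hn ▸ hlt) u hu rfl
      refine ⟨u :: l, by simp [List.isChain_cons_cons, ha, hlt, h1], ?_, ?_⟩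
      · intro w hw
        rcases List.mem_cons.1 hw with rfl | hw
        exacts [hv, h2 w hw]
      · simpa [List.getLast?_cons_cons] using h3

theorem pairwise_of_chain {G : SimpleGraph V} {r : V → ℕ} {l : List V}
    (h : l.IsChain (fun a b => G.Adj a b ∧ r b < r a)) : l.Pairwise (fun a b => r b < r a) := by
  have : l.IsChain (fun a b => r b < r a) := h.imp fun _ _ h => h.2
  have inst : Trans (fun a b => r b < r a) (fun a b => r b < r a) (fun a b : V => r b < r a) :=
    ⟨fun h1 h2 => h2.trans h1⟩
  exact List.isChain_iff_pairwise.1 this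

/-- The lengths of increasing paths give a proper colouring. -/
theorem exists_height [Finite V] {G : SimpleGraph V} {A : Set V} {r : V → ℕ} (hr : InjOn r A) :
    ∃ h : V → ℕ, (∀ u ∈ A, ∀ v ∈ A, G.Adj u v → h u ≠ h v) ∧ ∀ w ∈ A, 1 ≤ h w ∧
      ∀ j, 1 ≤ j → j ≤ h w → ∃ l : List V, l.length = j ∧ (∀ u ∈ l, u ∈ A) ∧
        (∀ u ∈ l, r w ≤ r u) ∧ l.Nodup ∧ l.IsChain G.Adj ∧ ∀ a ∈ l.getLast?, a = w := by
  classical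
  have := Fintype.ofFinite V
  let L : V → Set ℕ := fun w => {n | ∃ l : List V, l.length = n ∧ (∀ u ∈ l, u ∈ A) ∧
    l.IsChain (fun a b => G.Adj a b ∧ r b < r a) ∧ l.getLast? = some w}
  have hbdd : ∀ w, BddAbove (L w) := by
    rintro w
    refine ⟨Fintype.card V, ?_⟩
    rintro _ ⟨l, rfl, -, hl, -⟩
    apply List.Nodup.length_le_card
    exact (pairwise_of_chain hl).imp fun h1 h2 => by subst h2; exact lt_irrefl _ h1
  have h1 : ∀ w ∈ A, 1 ∈ L w := fun w hw => ⟨[w], rfl, by simpa, by simp, rfl⟩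
  have hmem : ∀ w ∈ A, sSup (L w) ∈ L w := fun w hw => Nat.sSup_mem ⟨1, h1 w hw⟩ (hbdd w)
  have hlt : ∀ u ∈ A, ∀ v ∈ A, G.Adj u v → r u < r v → sSup (L v) < sSup (L u) := by
    intro u hu v hv ha hlt
    obtain ⟨l, hl, hA, hc, hlast⟩ := hmem v hv
    have : sSup (L v) + 1 ∈ L u := by
      refine ⟨l ++ [u], by simp [hl], ?_, ?_, by simp⟩
      · intro w hw
        rcases List.mem_append.1 hw with hw | hw
        · exact hA w hw
        · simpa [List.mem_singleton.1 hw]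
      · rw [List.isChain_append]
        refine ⟨hc, by simp, ?_⟩
        intro x hx y hy
        rw [hlast] at hx
        simp at hx hy
        subst hx hy
        exact ⟨ha.symm, hlt⟩
    exact le_csSup (hbdd u) this
  refine ⟨fun w => sSup (L w), ?_, ?_⟩
  · intro u hu v hv ha
    rcases lt_trichotomy (r u) (r v) with h | h | h
    · exact (hlt u hu v hv ha h).ne'
    · exact absurd (hr hu hv h) ha.ne
    · exact (hlt v hv u hu ha.symm h).ne
  · intro w hw
    refine ⟨le_csSup (hbdd w) (h1 w hw), fun j hj1 hj => ?_⟩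
    obtain ⟨l, hl, hA, hc, hlast⟩ := hmem w hw
    have hp := pairwise_of_chain hc
    have hsub : ∀ u ∈ l.drop (l.length - j), u ∈ l := fun u hu => List.mem_of_mem_drop hu
    have hne : l.drop (l.length - j) ≠ [] := by
      intro h0
      have := congrArg List.length h0
      simp at this
      have : 1 ≤ l.length := by rw [hl]; exact hj1.trans hj
      omega
    have hl2 : (l.drop (l.length - j)).getLast? = some w := by
      have h3 := List.take_append_drop (l.length - j) l
      rw [← h3, List.getLast?_append] at hlast
      cases h4 : (l.drop (l.length - j)).getLast? with
      | none => exact absurd (List.getLast?_eq_none_iff.1 h4) hne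
      | some z => rw [h4] at hlast; simpa using hlast
    refine ⟨l.drop (l.length - j), ?_, fun u hu => hA u (hsub u hu), fun u hu => ?_, ?_, ?_, ?_⟩
    · have : j ≤ l.length := hl ▸ hj
      simp; omega
    · have hu := hsub u hu
      obtain ⟨l', rfl⟩ := List.getLast?_eq_some_iff.1 hlast
      rcases List.mem_append.1 hu with h | h
      · exact ((List.pairwise_append.1 hp).2.2 u h w (by simp)).le
      · rw [List.mem_singleton.1 h]
    · exact (List.drop_sublist _ _).nodup
        (hp.imp fun h1 h2 => by subst h2; exact lt_irrefl _ h1)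
    · exact (hc.imp fun _ _ h => h.1).drop _
    · rw [hl2]; simp

/-- Where a path has to end in order to be continued by `ρ` (or, if `ρ` is empty, to end in
`B`). -/
def target (G : SimpleGraph V) (B : Set V) : List V → Set V
  | [] => B
  | h :: _ => {p | G.Adj p h}

/-- Vertices with a neighbour in `A` other than the first vertex of `ρ`. -/
def attach (G : SimpleGraph V) (A : Set V) (ρ : List V) : Set V :=
  {p | ∃ w ∈ A, w ∉ ρ.head? ∧ G.Adj p w}

/-- A piece of `Z \ A` from which `B` can be reached through a fixed route `ρ`. -/
structure Gated (G : SimpleGraph V) (Z A B : Set V) (r : V → ℕ) (P : Set V) (ρ : List V)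
    (γ : ℕ) : Prop where
  nonempty : P.Nonempty
  sub : P ⊆ Z
  notMem : ∀ p ∈ P, p ∉ A
  mem : ∀ u ∈ ρ, u ∈ Z ∧ u ∉ P
  nodup : ρ.Nodup
  chain : ρ.IsChain G.Adj
  last : ∀ b ∈ ρ.getLast?, b ∈ B
  linked : TwoLinked G P (attach G A ρ) (target G B ρ)
  avoid : ρ ≠ [] → ∀ p ∈ P, p ∉ B
  low : ∀ w ∈ A, w ∉ ρ.head? → (∃ p ∈ P, G.Adj p w) → ∀ u ∈ ρ, u ∈ A → r u < r w
  zero : ρ = [] → γ = 0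

/-- A colouring of `P` compatible with the heights `Φ` on `A` and the route `ρ`. -/
def Fits (G : SimpleGraph V) (A B : Set V) (Φ : V → ℕ) (m : ℕ) (P : Set V) (ρ : List V)
    (γ : ℕ) (f : V → ℕ) : Prop :=
  ColorsOn G P (Finset.range m) f ∧
    (∀ p ∈ P, ∀ w ∈ A, w ∉ ρ.head? → G.Adj p w → f p ≠ Φ w) ∧
    ∀ p ∈ P, p ∈ target G B ρ → f p ≠ γ

section Minimal

variable {G : SimpleGraph V} {Z A B : Set V} {r Φ : V → ℕ} {m γ : ℕ} {P : Set V} {ρ : List V}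

/-- Two colourings can be glued along a partition when the crossing edges are fine. -/
theorem ColorsOn.glue {P Q : Set V} {C : Finset ℕ} {f g : V → ℕ} [DecidablePred (· ∈ Q)]
    (hf : ColorsOn G (P \ Q) C f) (hg : ColorsOn G (P ∩ Q) C g)
    (h : ∀ u ∈ P ∩ Q, ∀ v ∈ P \ Q, G.Adj u v → g u ≠ f v) :
    ColorsOn G P C (fun v => if v ∈ Q then g v else f v) := by
  refine ⟨fun v hv => ?_, fun u hu v hv ha => ?_⟩
  · by_cases hQ : v ∈ Q
    · simpa [hQ] using hg.1 v ⟨hv, hQ⟩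
    · simpa [hQ] using hf.1 v ⟨hv, hQ⟩
  · by_cases h1 : u ∈ Q <;> by_cases h2 : v ∈ Q <;> simp only [h1, h2, if_true, if_false]
    · exact hg.2 u ⟨hu, h1⟩ v ⟨hv, h2⟩ ha
    · exact h u ⟨hu, h1⟩ v ⟨hv, h2⟩ ha
    · exact (h v ⟨hv, h2⟩ u ⟨hu, h1⟩ ha.symm).symm
    · exact hf.2 u ⟨hu, h1⟩ v ⟨hv, h2⟩ ha

/-- Gluing two fitting colourings without crossing edges. -/
theorem Fits.glue {Q : Set V} {f g : V → ℕ} [DecidablePred (· ∈ Q)]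
    (hf : Fits G A B Φ m (P \ Q) ρ γ f) (hg : ColorsOn G (P ∩ Q) (Finset.range m) g)
    (hg1 : ∀ p ∈ P ∩ Q, ∀ w ∈ A, w ∉ ρ.head? → G.Adj p w → g p ≠ Φ w)
    (hg2 : ∀ p ∈ P ∩ Q, p ∈ target G B ρ → g p ≠ γ)
    (h : ∀ u ∈ P ∩ Q, ∀ v ∈ P \ Q, G.Adj u v → g u ≠ f v) :
    Fits G A B Φ m P ρ γ (fun v => if v ∈ Q then g v else f v) := by
  refine ⟨hf.1.glue hg h, fun p hp w hw hh ha => ?_, fun p hp hh => ?_⟩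
  · by_cases h1 : p ∈ Q <;> simp only [h1, if_true, if_false]
    · exact hg1 p ⟨hp, h1⟩ w hw hh ha
    · exact hf.2.1 p ⟨hp, h1⟩ w hw hh ha
  · by_cases h1 : p ∈ Q <;> simp only [h1, if_true, if_false]
    · exact hg2 p ⟨hp, h1⟩ hh
    · exact hf.2.2 p ⟨hp, h1⟩ hh

/-- Restricting a gated piece. -/
theorem Gated.restrict (hP : Gated G Z A B r P ρ γ) {Q : Set V} (hQ : Q ⊆ P) (hne : Q.Nonempty)
    (hl : TwoLinked G Q (attach G A ρ) (target G B ρ)) : Gated G Z A B r Q ρ γ where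
  nonempty := hne
  sub := hQ.trans hP.sub
  notMem p hp := hP.notMem p (hQ hp)
  mem u hu := ⟨(hP.mem u hu).1, fun h => (hP.mem u hu).2 (hQ h)⟩
  nodup := hP.nodup
  chain := hP.chain
  last := hP.last
  linked := hl
  avoid h p hp := hP.avoid h p (hQ hp)
  low w hw hh := fun ⟨p, hp, ha⟩ => hP.low w hw hh ⟨p, hQ hp, ha⟩
  zero := hP.zero

/-- A set without edges to the rest inherits `TwoLinked`. -/
theorem TwoLinked.of_closed {A' B' : Set V} (h : TwoLinked G P A' B') {Q : Set V} (hQ : Q ⊆ P)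
    (hc : ∀ u ∈ Q, ∀ v ∈ P \ Q, ¬ G.Adj u v) : TwoLinked G Q A' B' := by
  intro R hR hne e
  obtain ⟨e', he, hx⟩ := h R (hR.trans hQ) hne e
  refine ⟨e', he, ?_⟩
  rcases e' with w | (_ | _)
  · obtain ⟨hw, hwR, q, hq, ha⟩ := hx
    refine ⟨by_contra fun hwQ => hc q (hR hq) w ⟨hw, hwQ⟩ ha, hwR, q, hq, ha⟩
  · exact hx
  · exact hx

/-- A minimal gated piece that has no fitting colouring is connected. -/
theorem Gated.connected (hP : Gated G Z A B r P ρ γ) 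
    (hbad : ¬ ∃ f, Fits G A B Φ m P ρ γ f)
    (hmin : ∀ P' ⊂ P, Gated G Z A B r P' ρ γ → ∃ f, Fits G A B Φ m P' ρ γ f)
    {Q : Set V} (hQ : Q ⊆ P) (hne : Q.Nonempty) (hc : ∀ u ∈ Q, ∀ v ∈ P \ Q, ¬ G.Adj u v) :
    Q = P := by
  classical
  by_contra hQP
  have h1 : (P \ Q).Nonempty := Set.sdiff_nonempty.2 fun h => hQP (hQ.antisymm h)
  obtain ⟨f, hf⟩ := hmin (P \ Q) ⟨sdiff_subset, fun h => by
      obtain ⟨q, hq⟩ := hne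
      exact (h (hQ hq)).2 hq⟩ (hP.restrict sdiff_subset h1 (hP.linked.of_closed sdiff_subset
        (fun u hu v hv ha => hc v (by_contra fun h => hv.2 ⟨hv.1, h⟩) u hu ha.symm)))
  obtain ⟨g, hg⟩ := hmin Q (hQ.ssubset_of_ne hQP)
    (hP.restrict hQ hne (hP.linked.of_closed hQ hc))
  have hPQ : P ∩ Q = Q := Set.inter_eq_right.2 hQ
  refine hbad ⟨_, hf.glue (Q := Q) (g := g) ?_ ?_ ?_ ?_⟩ <;> rw [hPQ]
  · exact hg.1
  · exact hg.2.1
  · exact hg.2.2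
  · exact fun u hu v hv ha => absurd ha (hc u hu v hv)

/-- In a connected set, some path avoiding `Q` joins a given vertex to a given nonempty set,
provided `Q` is attached at that vertex only. -/
theorem exists_path_avoiding [Finite V] {Q T : Set V} {b : V} (hb : b ∈ P \ Q)
    (hconn : ∀ R ⊆ P, R.Nonempty → (∀ u ∈ R, ∀ v ∈ P \ R, ¬ G.Adj u v) → R = P)
    (hQ : Q ⊆ P) (hQb : ∀ u ∈ Q, ∀ v ∈ P \ Q, G.Adj u v → v = b) (hT : (T ∩ (P \ Q)).Nonempty) :
    ∃ l : List V, (b :: l).Nodup ∧ (b :: l).IsChain G.Adj ∧ (∀ u ∈ b :: l, u ∈ P \ Q) ∧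
      ∀ t ∈ (b :: l).getLast?, t ∈ T := by
  classical
  let R : Set V := {t | ∃ l : List V, (b :: l).Nodup ∧ (b :: l).IsChain G.Adj ∧
    (∀ u ∈ b :: l, u ∈ P \ Q) ∧ (b :: l).getLast? = some t}
  have hbR : b ∈ R := ⟨[], by simp, by simp, by simpa using hb, rfl⟩
  have hRP : ∀ t ∈ R, t ∈ P \ Q := fun t ⟨l, _, _, h, h'⟩ => h t (List.mem_of_getLast? h')
  have key : R ∪ Q = P := by
    refine hconn _ (Set.union_subset (fun t ht => (hRP t ht).1) hQ) ⟨b, Or.inl hbR⟩ ?_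
    rintro u hu v ⟨hvP, hv⟩ ha
    simp only [Set.mem_union, not_or] at hv
    rcases hu with ⟨l, h1, h2, h3, h4⟩ | hu
    · apply hv.1
      by_cases hvl : v ∈ b :: l
      · obtain ⟨s, t, hst⟩ := List.append_of_mem hvl
        have hpre : (s ++ [v]) <+: (b :: l) := ⟨t, by simp [hst]⟩
        rcases s with _ | ⟨b', s⟩
        · have : b = v := by simpa using congrArg List.head? hst
          exact absurd (this ▸ hbR) hv.1
        · have hbb : b = b' := by simpa using congrArg List.head? hst
          subst hbb
          refine ⟨s ++ [v], hpre.sublist.nodup h1, h2.prefix hpre, 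
            fun u hu => h3 u (hpre.sublist.subset hu), ?_⟩
          rw [← List.cons_append, List.getLast?_append]; simp
      · refine ⟨l ++ [v], ?_, ?_, ?_, ?_⟩
        · rw [← List.cons_append, List.nodup_append]
          exact ⟨h1, by simp, fun a ha' c hc hac => by
            rw [List.mem_singleton.1 hc] at hac; exact hvl (hac ▸ ha')⟩
        · rw [← List.cons_append, List.isChain_append]
          refine ⟨h2, by simp, fun x hx y hy => ?_⟩
          rw [h4] at hx
          simp at hx hy
          subst hx hy
          exact ha
        · intro w hw
          rw [← List.cons_append, List.mem_append] at hw
          rcases hw with hw | hw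
          · exact h3 w hw
          · rw [List.mem_singleton.1 hw]; exact ⟨hvP, hv.2⟩
        · rw [← List.cons_append, List.getLast?_append]; simp
    · exact hv.1 (hQb u hu v ⟨hvP, hv.2⟩ ha ▸ hbR)
  obtain ⟨t, htT, htP, htQ⟩ := hT
  have : t ∈ R := (key.symm.subset htP).resolve_right htQ
  obtain ⟨l, h1, h2, h3, h4⟩ := this
  exact ⟨l, h1, h2, h3, fun t' ht' => by rw [h4] at ht'; simp at ht'; exact ht' ▸ htT⟩

/-- `Q` is attached to the rest of `P` at `b` only and avoids the sets `S` and `T`. -/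
structure Pendant (G : SimpleGraph V) (P S T Q : Set V) (b : V) : Prop where
  sub : Q ⊆ P
  nonempty : Q.Nonempty
  gate : b ∈ P \ Q
  only : ∀ u ∈ Q, ∀ v ∈ P \ Q, G.Adj u v → v = b
  left : ∀ q ∈ Q, q ∉ S
  right : ∀ q ∈ Q, q ∉ T

theorem Gated.not_pendant [Finite V] (hP : Gated G Z A B r P ρ γ)
    (hbad : ¬ ∃ f, Fits G A B Φ m P ρ γ f) (hγ : γ < m)
    (hmin : ∀ P' ⊂ P, ∀ ρ' γ', γ' < m → Gated G Z A B r P' ρ' γ' →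
      ∃ f, Fits G A B Φ m P' ρ' γ' f)
    {S : Set V} (hS : S ⊆ attach G A ρ) (hSP : (S ∩ P).Nonempty) (Q : Set V) (b : V) :
    ¬ Pendant G P S (target G B ρ) Q b := by
  classical
  intro hQb
  obtain ⟨Q, ⟨b, hQ⟩, hmax⟩ := Set.Finite.exists_maximal
    (s := {Q : Set V | ∃ b, Pendant G P S (target G B ρ) Q b}) (Set.toFinite _) ⟨Q, b, hQb⟩
  have hconn : ∀ R ⊆ P, R.Nonempty → (∀ u ∈ R, ∀ v ∈ P \ R, ¬ G.Adj u v) → R = P :=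
    fun R hR hne hc => hP.connected hbad (fun P' h h' => hmin P' h ρ γ hγ h') hR hne hc
  have hrest : TwoLinked G (P \ Q) (attach G A ρ) (target G B ρ) := by
    intro R hR hne e
    by_contra! hcon
    have hcon : ∀ e', Exit G (P \ Q) (attach G A ρ) (target G B ρ) R e' → e' = e :=
      fun e' h => by_contra fun h' => hcon e' h' h
    by_cases hbR : b ∈ R
    · have hRa : ∀ q ∈ R, q ∈ attach G A ρ → e = .inr true := 
        fun q hq ha => (hcon (.inr true) ⟨q, hq, ha⟩).symm
      have hadj : ∀ u ∈ R ∪ Q, ∀ v ∈ P \ (R ∪ Q), G.Adj u v → e = .inl v := by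
        rintro u hu v ⟨hvP, hv⟩ ha
        simp only [Set.mem_union, not_or] at hv
        rcases hu with hu | hu
        · exact (hcon (.inl v) ⟨⟨hvP, hv.2⟩, hv.1, u, hu, ha⟩).symm
        · exact absurd (hQ.only u hu v ⟨hvP, hv.2⟩ ha ▸ hbR) hv.1
      have hsub : R ∪ Q ⊆ P := Set.union_subset (hR.trans sdiff_subset) hQ.sub
      obtain ⟨e', he', hx⟩ := hP.linked (R ∪ Q) hsub ⟨b, Or.inl hbR⟩ (.inr true)
      rcases e' with v | (_ | _)
      · obtain ⟨hv, hvRQ, q, hq, ha⟩ := hx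
        have hev := hadj q hq v ⟨hv, hvRQ⟩ ha
        have hp : Pendant G P S (target G B ρ) (R ∪ Q) v := by
          refine ⟨hsub, ⟨b, Or.inl hbR⟩, ⟨hv, hvRQ⟩, fun u hu w hw ha => ?_, ?_, ?_⟩
          · have := hadj u hu w hw ha
            rw [hev] at this
            exact (Sum.inl_injective this).symm
          · rintro q (hq | hq) hqS
            · have := hRa q hq (hS hqS)
              rw [hev] at this
              cases this
            · exact hQ.left q hq hqS
          · rintro q (hq | hq) hqS
            · have := hcon (.inr false) ⟨q, hq, hqS⟩
              rw [hev] at this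
              cases this
            · exact hQ.right q hq hqS
        exact hQ.gate.2 (hmax ⟨v, hp⟩ Set.subset_union_right (Or.inl hbR))
      · obtain ⟨q, hq, hT⟩ := hx
        have hqR : q ∈ R := hq.resolve_right fun h => hQ.right q h hT
        have he := hcon (.inr false) ⟨q, hqR, hT⟩
        have hPP := hconn (R ∪ Q) hsub ⟨b, Or.inl hbR⟩ (fun u hu v hv ha => by
          have := hadj u hu v hv ha
          rw [← he] at this
          cases this)
        obtain ⟨s, hsS, hsP⟩ := hSP
        rcases hPP.symm.subset hsP with h | h
        · have := hRa s h (hS hsS)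
          rw [← he] at this
          cases this
        · exact hQ.left s h hsS
      · exact he' rfl
    · obtain ⟨e', he', hx⟩ := hP.linked R (hR.trans sdiff_subset) hne e
      refine he' (hcon e' ?_)
      rcases e' with v | (_ | _)
      · obtain ⟨hv, hvR, q, hq, ha⟩ := hx
        refine ⟨⟨hv, fun hvQ => ?_⟩, hvR, q, hq, ha⟩
        exact hbR (hQ.only v hvQ q (hR hq) ha.symm ▸ hq)
      · exact hx
      · exact hx
  obtain ⟨f, hf⟩ := hmin (P \ Q) ⟨sdiff_subset, fun h => by
      obtain ⟨q, hq⟩ := hQ.nonempty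
      exact (h (hQ.sub hq)).2 hq⟩ ρ γ hγ (hP.restrict sdiff_subset ⟨b, hQ.gate⟩ hrest)
  have hT : (target G B ρ ∩ (P \ Q)).Nonempty := by
    obtain ⟨e, he, hx⟩ := hP.linked P subset_rfl hP.nonempty (.inr true)
    rcases e with v | (_ | _)
    · exact absurd hx.1 hx.2.1
    · obtain ⟨q, hq, hx⟩ := hx
      exact ⟨q, hx, hq, fun h => hQ.right q h hx⟩
    · exact absurd rfl he
  obtain ⟨l, hl1, hl2, hl3, hl4⟩ := exists_path_avoiding hQ.gate hconn hQ.sub hQ.only hT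
  have hbA : b ∉ A := hP.notMem b hQ.gate.1
  have hhead : ∀ w ∈ A, w ∉ (b :: l ++ ρ).head? := by
    intro w hw h
    simp at h
    exact hbA (h ▸ hw)
  have hgQ : Gated G Z A B r Q (b :: l ++ ρ) (f b) := by
    refine ⟨hQ.nonempty, hQ.sub.trans hP.sub, fun p hp => hP.notMem p (hQ.sub hp), ?_, ?_, ?_, ?_,
      ?_, ?_, ?_, ?_⟩
    · intro u hu
      rcases List.mem_append.1 hu with hu | hu
      · exact ⟨hP.sub (hl3 u hu).1, (hl3 u hu).2⟩
      · exact ⟨(hP.mem u hu).1, fun h => (hP.mem u hu).2 (hQ.sub h)⟩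
    · exact List.nodup_append.2 ⟨hl1, hP.nodup, fun a ha c hc hac =>
        (hP.mem c hc).2 (hac ▸ (hl3 a ha).1)⟩
    · refine List.isChain_append.2 ⟨hl2, hP.chain, fun x hx y hy => ?_⟩
      have := hl4 x hx
      rcases ρ with _ | ⟨h, ρ⟩
      · simp at hy
      · simp at hy
        subst hy
        exact this
    · intro t ht
      rw [List.getLast?_append] at ht
      rcases h : ρ.getLast? with _ | z
      · rw [h] at ht
        have h0 : ρ = [] := List.getLast?_eq_none_iff.1 h
        have := hl4 t (by simpa using ht)
        rw [h0] at this
        exact this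
      · rw [h] at ht
        exact hP.last t (by rw [h]; simpa using ht)
    · intro R hR hne e
      obtain ⟨e', he', hx⟩ := hP.linked R (hR.trans hQ.sub) hne
        (if e = .inr false then .inl b else e)
      rcases e' with v | (_ | _)
      · obtain ⟨hv, hvR, q, hq, ha⟩ := hx
        by_cases hvQ : v ∈ Q
        · refine ⟨.inl v, fun h => ?_, hvQ, hvR, q, hq, ha⟩
          rw [← h] at he'
          simp at he'
        · have hvb := hQ.only q (hR hq) v ⟨hv, hvQ⟩ ha
          subst hvb
          refine ⟨.inr false, fun h => ?_, q, hq, ha⟩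
          rw [← h] at he'
          simp at he'
      · obtain ⟨q, hq, hx⟩ := hx
        exact absurd hx (hQ.right q (hR hq))
      · obtain ⟨q, hq, w, hw, hwh, ha⟩ := hx
        refine ⟨.inr true, fun h => ?_, q, hq, w, hw, hhead w hw, ha⟩
        rw [← h] at he'
        simp at he'
    · intro _ p hp hpB
      rcases ρ with _ | ⟨h, ρ⟩
      · exact hQ.right p hp hpB
      · exact hP.avoid (by simp) p (hQ.sub hp) hpB
    · rintro w hw hwh ⟨p, hp, ha⟩ u hu huA
      rcases List.mem_append.1 hu with hu | hu
      · exact absurd huA (hP.notMem u (hl3 u hu).1)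
      · refine hP.low w hw (fun hh => ?_) ⟨p, hQ.sub hp, ha⟩ u hu huA
        rcases ρ with _ | ⟨h, ρ⟩
        · simp at hh
        · simp at hh
          subst hh
          exact hQ.right p hp ha
    · simp
  obtain ⟨g, hg⟩ := hmin Q (ssubset_iff_subset_ne.2 ⟨hQ.sub, fun h => hQ.gate.2 (h ▸ hQ.gate.1)⟩)
    _ _ (by simpa using hf.1.1 b hQ.gate) hgQ
  have hPQ : P ∩ Q = Q := Set.inter_eq_right.2 hQ.sub
  refine hbad ⟨_, hf.glue (Q := Q) (g := g) ?_ ?_ ?_ ?_⟩ <;> rw [hPQ]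
  · exact hg.1
  · exact fun p hp w hw _ ha => hg.2.1 p hp w hw (hhead w hw) ha
  · exact fun p hp ht => absurd ht (hQ.right p hp)
  · intro u hu v hv ha
    have := hQ.only u hu v hv ha
    subst this
    exact hg.2.2 u hu ha

theorem Gated.twoLinked [Finite V] (hP : Gated G Z A B r P ρ γ)
    (hbad : ¬ ∃ f, Fits G A B Φ m P ρ γ f) (hγ : γ < m)
    (hmin : ∀ P' ⊂ P, ∀ ρ' γ', γ' < m → Gated G Z A B r P' ρ' γ' →
      ∃ f, Fits G A B Φ m P' ρ' γ' f)
    {S : Set V} (hS : S ⊆ attach G A ρ) (hSP : (S ∩ P).Nonempty) :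
    TwoLinked G P S (target G B ρ) := by
  intro Q hQ hne e
  by_contra! hcon
  have hcon : ∀ e', Exit G P S (target G B ρ) Q e' → e' = e :=
    fun e' h => by_contra fun h' => hcon e' h' h
  by_cases hc : ∀ u ∈ Q, ∀ v ∈ P \ Q, ¬ G.Adj u v
  · have hQP : Q = P :=
      hP.connected hbad (fun P' h h' => hmin P' h ρ γ hγ h') hQ hne hc
    subst hQP
    obtain ⟨s, hsS, hs⟩ := hSP
    have h1 := hcon (.inr true) ⟨s, hs, hsS⟩
    obtain ⟨e', he', hx⟩ := hP.linked Q subset_rfl hne e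
    rcases e' with v | (_ | _)
    · exact absurd hx.1 hx.2.1
    · exact he' (hcon (.inr false) hx)
    · exact he' h1
  · push Not at hc
    obtain ⟨u, hu, b, hb, ha⟩ := hc
    have h1 := hcon (.inl b) ⟨hb.1, hb.2, u, hu, ha⟩
    subst h1
    refine hP.not_pendant hbad hγ hmin hS hSP Q b ⟨hQ, hne, hb, ?_, ?_, ?_⟩
    · exact fun u hu v hv ha => Sum.inl_injective (hcon (.inl v) ⟨hv.1, hv.2, u, hu, ha⟩)
    · exact fun q hq hS => by cases hcon (.inr true) ⟨q, hq, hS⟩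
    · exact fun q hq hS => by cases hcon (.inr false) ⟨q, hq, hS⟩

end Minimal

section Core

variable {G : SimpleGraph V} {Z A B : Set V} {r Φ : V → ℕ} {m : ℕ}

theorem twoLinked_of_connected {P S T : Set V} (hZ : TwoLinked G Z A B)
    (hPZ : P ⊆ Z) (hPA : ∀ p ∈ P, p ∉ A)
    (hclosed : ∀ u ∈ P, ∀ v ∈ Z, v ∉ A → G.Adj u v → v ∈ P)
    (hconn : ∀ R ⊆ P, R.Nonempty → (∀ u ∈ R, ∀ v ∈ P \ R, ¬ G.Adj u v) → R = P)
    (hS : (S ∩ P).Nonempty) (hT : (T ∩ P).Nonempty)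
    (hA : ∀ q ∈ P, ∀ w ∈ A ∩ Z, G.Adj q w → q ∈ S ∨ q ∈ T) (hB : ∀ q ∈ P, q ∈ B → q ∈ T) :
    TwoLinked G P S T := by
  intro Q hQ hne e
  by_contra! hcon
  have hcon : ∀ e', Exit G P S T Q e' → e' = e := fun e' h => by_contra fun h' => hcon e' h' h
  by_cases hc : ∀ u ∈ Q, ∀ v ∈ P \ Q, ¬ G.Adj u v
  · have := hconn Q hQ hne hc
    subst this
    obtain ⟨s, hs, hsQ⟩ := hS
    obtain ⟨t, ht, htQ⟩ := hT
    cases (hcon (.inr true) ⟨s, hsQ, hs⟩).trans (hcon (.inr false) ⟨t, htQ, ht⟩).symm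
  · push Not at hc
    obtain ⟨u, hu, v, hv, ha⟩ := hc
    have h1 := hcon (.inl v) ⟨hv.1, hv.2, u, hu, ha⟩
    subst h1
    obtain ⟨e', he', hx⟩ := hZ Q (hQ.trans hPZ) hne (.inl v)
    rcases e' with w | (_ | _)
    · obtain ⟨hw, hwQ, q, hq, ha⟩ := hx
      by_cases hwP : w ∈ P
      · exact he' (hcon (.inl w) ⟨hwP, hwQ, q, hq, ha⟩)
      · have hwA : w ∈ A := by_contra fun h => hwP (hclosed q (hQ hq) w hw h ha)
        rcases hA q (hQ hq) w ⟨hwA, hw⟩ ha with h | h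
        · cases hcon (.inr true) ⟨q, hq, h⟩
        · cases hcon (.inr false) ⟨q, hq, h⟩
    · obtain ⟨q, hq, hx⟩ := hx
      cases hcon (.inr false) ⟨q, hq, hB q (hQ hq) hx⟩
    · obtain ⟨q, hq, hx⟩ := hx
      exact hPA q (hQ hq) hx

/-- If the heights on `A` do not extend to `Z`, some gated piece is not colourable. -/
theorem exists_gated [Finite V] (hZ : TwoLinked G Z A B) (hr : InjOn r Z)
    (hd : ∀ v ∈ Z, v ∉ B → ∃ u ∈ Z, G.Adj v u ∧ r u < r v)
    (hΦ : ∀ u ∈ A ∩ Z, ∀ v ∈ A ∩ Z, G.Adj u v → Φ u ≠ Φ v)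
    (hΦ1 : ∀ w ∈ A ∩ Z, 1 ≤ Φ w ∧ Φ w + 2 ≤ m) (hm : 0 < m) {α : ℕ} (hα : α = 0 ∨ α = m - 1)
    (hcol : ¬ TypedColorable G Z A B (Finset.range m) α 0) :
    ∃ P ρ γ, γ < m ∧ Gated G Z (A ∩ Z) B r P ρ γ ∧ ¬ ∃ f, Fits G (A ∩ Z) B Φ m P ρ γ f := by
  classical
  let Good : Set V → Prop := fun P => ∃ f, ColorsOn G P (Finset.range m) f ∧
    (∀ p ∈ P, ∀ w ∈ A ∩ Z, G.Adj p w → f p ≠ Φ w) ∧ ∀ p ∈ P, p ∈ B → f p ≠ 0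
  let Clo : Set V → Prop := fun P => P ⊆ Z \ A ∧ ∀ u ∈ P, ∀ v ∈ Z, v ∉ A → G.Adj u v → v ∈ P
  have h0 : ¬ Good (Z \ A) := by
    rintro ⟨f, hf1, hf2, hf3⟩
    refine hcol ⟨fun v => if v ∈ A then Φ v else f v, 
      hf1.glue (Q := A) (g := Φ) ⟨fun v hv => ?_, fun u hu v hv => hΦ u hu.symm v hv.symm⟩ ?_, ?_, ?_⟩
    · have := hΦ1 v hv.symm
      simp only [Finset.mem_range]; omega
    · exact fun u hu v hv ha => (hf2 v hv u hu.symm ha.symm).symm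
    · intro v hv hvA
      have := hΦ1 v ⟨hvA, hv⟩
      simp only [hvA, if_true]; omega
    · intro v hv hvB
      by_cases hvA : v ∈ A
      · have := hΦ1 v ⟨hvA, hv⟩
        simp only [hvA, if_true]; omega
      · simpa only [hvA, if_false] using hf3 v ⟨hv, hvA⟩ hvB
  obtain ⟨P, ⟨⟨hPs, hPc⟩, hPb⟩, hPmin⟩ := Set.Finite.exists_minimal
    (s := {P : Set V | Clo P ∧ ¬ Good P}) (Set.toFinite _)
    ⟨Z \ A, ⟨subset_rfl, fun u _ v hv hvA _ => ⟨hv, hvA⟩⟩, h0⟩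
  have hmin : ∀ Q ⊆ P, Q ≠ P → Clo Q → Good Q := fun Q hQ hne hc =>
    by_contra fun h => hne (hQ.antisymm (hPmin ⟨hc, h⟩ hQ))
  have hconn : ∀ R ⊆ P, R.Nonempty → (∀ u ∈ R, ∀ v ∈ P \ R, ¬ G.Adj u v) → R = P := by
    intro R hR hne hc
    by_contra hRP
    obtain ⟨f, hf1, hf2, hf3⟩ := hmin (P \ R) sdiff_subset (fun h => by
      obtain ⟨x, hx⟩ := hne
      exact (h.symm.subset (hR hx)).2 hx) ⟨sdiff_subset.trans hPs, fun u hu v hv hvA ha => 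
        ⟨hPc u hu.1 v hv hvA ha, fun hvR => hc v hvR u hu ha.symm⟩⟩
    obtain ⟨g, hg1, hg2, hg3⟩ := hmin R hR hRP ⟨hR.trans hPs, fun u hu v hv hvA ha =>
      by_contra fun h => hc u hu v ⟨hPc u (hR hu) v hv hvA ha, h⟩ ha⟩
    have hPR : P ∩ R = R := Set.inter_eq_right.2 hR
    refine hPb ⟨_, hf1.glue (Q := R) (g := g) (hPR.symm ▸ hg1)
      (fun u hu v hv ha => absurd ha (hc u hu.2 v hv)), fun p hp w hw ha => ?_, fun p hp hB => ?_⟩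
    · by_cases h1 : p ∈ R <;> simp only [h1, if_true, if_false]
      · exact hg2 p h1 w hw ha
      · exact hf2 p ⟨hp, h1⟩ w hw ha
    · by_cases h1 : p ∈ R <;> simp only [h1, if_true, if_false]
      · exact hg3 p h1 hB
      · exact hf3 p ⟨hp, h1⟩ hB
  have hPne : P.Nonempty := by
    by_contra h
    rw [Set.not_nonempty_iff_eq_empty] at h
    subst h
    exact hPb ⟨fun _ => 0, by simp [ColorsOn], by simp, by simp⟩
  have hPZ : P ⊆ Z := fun p hp => (hPs hp).1
  have hPA : ∀ p ∈ P, p ∉ A := fun p hp => (hPs hp).2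
  by_cases hPB : (B ∩ P).Nonempty
  · refine ⟨P, [], 0, hm, ⟨hPne, hPZ, fun p hp h => hPA p hp h.1, by simp, by simp, by simp,
      by simp, ?_, by simp, by simp, by simp⟩, ?_⟩
    · refine twoLinked_of_connected hZ hPZ hPA hPc hconn ?_ hPB
        (fun q hq w hw ha => Or.inl ⟨w, hw, by simp, ha⟩) (fun _ _ h => h)
      obtain ⟨e', he', hx⟩ := hZ P hPZ hPne (.inr false)
      rcases e' with w | (_ | _)
      · obtain ⟨hw, hwP, q, hq, ha⟩ := hx
        exact ⟨q, ⟨w, ⟨by_contra fun h => hwP (hPc q hq w hw h ha), hw⟩, by simp, ha⟩, hq⟩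
      · exact absurd rfl he'
      · obtain ⟨q, hq, hx⟩ := hx
        exact absurd hx (hPA q hq)
    · rintro ⟨f, h1, h2, h3⟩
      exact hPb ⟨f, h1, fun p hp w hw ha => h2 p hp w hw (by simp) ha, h3⟩
  · have hPB : ∀ p ∈ P, p ∉ B := fun p hp h => hPB ⟨p, h, hp⟩
    have hex : ∀ e, ∃ w ∈ A ∩ Z, e ≠ w ∧ ∃ p ∈ P, G.Adj p w := by
      intro e
      obtain ⟨e', he', hx⟩ := hZ P hPZ hPne (.inl e)
      rcases e' with w | (_ | _)
      · obtain ⟨hw, hwP, q, hq, ha⟩ := hx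
        exact ⟨w, ⟨by_contra fun h => hwP (hPc q hq w hw h ha), hw⟩, fun h => he' (h ▸ rfl), q, hq, ha⟩
      · obtain ⟨q, hq, hx⟩ := hx
        exact absurd hx (hPB q hq)
      · obtain ⟨q, hq, hx⟩ := hx
        exact absurd hx (hPA q hq)
    obtain ⟨p0, hp0⟩ := hPne
    obtain ⟨b, ⟨hbA, hbP⟩, hbmin⟩ := Set.exists_min_image {w | w ∈ A ∩ Z ∧ ∃ p ∈ P, G.Adj p w} r
      (Set.toFinite _) (by obtain ⟨w, hw, -, h⟩ := hex p0; exact ⟨w, hw, h⟩)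
    have hhigh : ∀ n, ∀ p ∈ P, r p = n → r b < r p := by
      intro n
      induction n using Nat.strong_induction_on with
      | _ n ih =>
        intro p hp hn
        obtain ⟨u, hu, ha, hlt⟩ := hd p (hPZ hp) (hPB p hp)
        by_cases huP : u ∈ P
        · exact (ih _ (hn ▸ hlt) u huP rfl).trans hlt
        · have : u ∈ A := by_contra fun h => huP (hPc p hp u hu h ha)
          exact (hbmin u ⟨⟨this, hu⟩, p, hp, ha⟩).trans_lt hlt
    obtain ⟨l, hl1, hl2, hl3⟩ := exists_descending hd b hbA.2
    have hpw := pairwise_of_chain hl1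
    have hle : ∀ u ∈ b :: l, r u ≤ r b := by
      intro u hu
      rcases List.mem_cons.1 hu with rfl | hu
      · exact le_rfl
      · exact ((List.pairwise_cons.1 hpw).1 u hu).le
    refine ⟨P, b :: l, Φ b, ?_, ⟨⟨p0, hp0⟩, hPZ, fun p hp h => hPA p hp h.1, ?_, ?_, ?_, hl3, ?_, ?_,
      ?_, by simp⟩, ?_⟩
    · have := hΦ1 b hbA; omega
    · exact fun u hu => ⟨hl2 u hu, fun h => (hle u hu).not_gt (hhigh _ u h rfl)⟩
    · exact hpw.imp fun h1 h2 => by subst h2; exact lt_irrefl _ h1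
    · exact hl1.imp fun _ _ h => h.1
    · refine twoLinked_of_connected hZ hPZ hPA hPc hconn ?_ ?_ ?_ (fun q hq h => absurd h (hPB q hq))
      · obtain ⟨w, hw, hne, p, hp, ha⟩ := hex b
        exact ⟨p, ⟨w, hw, by simpa using hne, ha⟩, hp⟩
      · obtain ⟨p, hp, ha⟩ := hbP
        exact ⟨p, ha, hp⟩
      · intro q hq w hw ha
        by_cases h : b = w
        · subst h; exact Or.inr ha
        · exact Or.inl ⟨w, hw, by simpa using h, ha⟩
    · exact fun _ => hPB
    · rintro w hw hwb ⟨p, hp, ha⟩ u hu huA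
      refine (hle u hu).trans_lt (lt_of_le_of_ne (hbmin w ⟨hw, p, hp, ha⟩) fun h => hwb ?_)
      simpa using hr hbA.2 hw.2 h
    · rintro ⟨f, h1, h2, h3⟩
      refine hPb ⟨f, h1, fun p hp w hw ha => ?_, fun p hp h => absurd h (hPB p hp)⟩
      by_cases h : b = w
      · subst h; exact h3 p hp ha
      · exact h2 p hp w hw (by simpa using h) ha

/-- The paths found in a gated piece extend to paths from `A` to `B`. -/
theorem Gated.extend {P : Set V} {ρ : List V} {γ : ℕ} (hP : Gated G Z (A ∩ Z) B r P ρ γ)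
    {S : Set V} {l a : List V} (hl : IsPathList G P S (target G B ρ) l) {w : V}
    (hw : w ∈ A ∩ Z) (hwρ : w ∉ ρ.head?) (hwl : ∀ x ∈ l.head?, G.Adj x w) (ha0 : a ≠ [])
    (haA : ∀ u ∈ a, u ∈ A ∩ Z) (har : ∀ u ∈ a, r w ≤ r u) (hand : a.Nodup)
    (hac : a.IsChain G.Adj) (halast : ∀ x ∈ a.getLast?, x = w) :
    IsPathList G Z A B (a ++ (l ++ ρ)) := by
  have hadj : ∃ p ∈ P, G.Adj p w := by
    obtain ⟨x, l', rfl⟩ := List.exists_cons_of_ne_nil hl.ne_nil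
    exact ⟨x, hl.mem x (by simp), hwl x (by simp)⟩
  refine ⟨by simp [ha0], ?_, ?_, ?_, ?_, ?_⟩
  · refine List.nodup_append.2 ⟨hand, List.nodup_append.2 ⟨hl.nodup, hP.nodup, fun x hx y hy h =>
      (hP.mem y hy).2 (h ▸ hl.mem x hx)⟩, fun x hx y hy h => ?_⟩
    subst h
    rcases List.mem_append.1 hy with hy | hy
    · exact hP.notMem x (hl.mem x hy) (haA x hx)
    · exact (har x hx).not_gt (hP.low w hw hwρ hadj x hy (haA x hx))
  · refine List.isChain_append.2 ⟨hac, List.isChain_append.2 ⟨hl.chain, hP.chain, ?_⟩, ?_⟩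
    · intro x hx y hy
      have := hl.last x hx
      rcases ρ with _ | ⟨h, ρ⟩
      · simp at hy
      · simp at hy
        subst hy
        exact this
    · intro x hx y hy
      rw [halast x hx]
      obtain ⟨z, l', rfl⟩ := List.exists_cons_of_ne_nil hl.ne_nil
      simp at hy
      subst hy
      exact (hwl z (by simp)).symm
  · intro v hv
    rcases List.mem_append.1 hv with hv | hv
    · exact (haA v hv).2
    rcases List.mem_append.1 hv with hv | hv
    · exact hP.sub (hl.mem v hv)
    · exact (hP.mem v hv).1
  · intro x hx
    obtain ⟨z, a', rfl⟩ := List.exists_cons_of_ne_nil ha0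
    simp at hx
    subst hx
    exact (haA z (by simp)).1
  · intro x hx
    rw [← List.append_assoc, List.getLast?_append] at hx
    rcases h : ρ.getLast? with _ | z
    · rw [h] at hx
      have h0 : ρ = [] := List.getLast?_eq_none_iff.1 h
      subst h0
      refine hl.last x ?_
      rw [List.getLast?_append] at hx
      rcases h : l.getLast? with _ | z
      · exact absurd (List.getLast?_eq_none_iff.1 h) hl.ne_nil
      · rw [h] at hx; simpa using hx
    · rw [h] at hx
      exact hP.last x (by rw [h]; simpa using hx)

end Core

/-- There is an injection between palettes with two prescribed values. -/
theorem exists_recolor {P P' : Finset ℕ} (hc : P.card ≤ P'.card) {α β α' β' : ℕ} (hα : α ∈ P)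
    (hβ : β ∈ P) (hα' : α' ∈ P') (hβ' : β' ∈ P') (h : α = β ↔ α' = β') :
    ∃ σ : ℕ → ℕ, InjOn σ P ∧ (∀ i ∈ P, σ i ∈ P') ∧ σ α = α' ∧ σ β = β' := by
  obtain ⟨g, hg, hgi⟩ : ∃ g : ℕ → ℕ, (∀ i ∈ P, g i ∈ P') ∧ InjOn g P := by
    obtain ⟨Q, hQ, hQc⟩ := Finset.exists_subset_card_eq hc
    let e := Finset.equivOfCardEq hQc.symm
    refine ⟨fun i => if h : i ∈ P then e ⟨i, h⟩ else 0, fun i hi => ?_, fun i hi j hj hij => ?_⟩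
    · simpa [hi] using hQ (e ⟨i, hi⟩).2
    · have hi : i ∈ P := hi
      have hj : j ∈ P := hj
      simpa [hi, hj, Subtype.coe_inj] using hij
  have hsw : ∀ x y z : ℕ, x ∈ P' → y ∈ P' → z ∈ P' → Equiv.swap x y z ∈ P' := by
    intro x y z hx hy hz
    rw [Equiv.swap_apply_def]
    split_ifs <;> assumption
  let g1 : ℕ → ℕ := fun i => Equiv.swap (g α) α' (g i)
  have hg1 : ∀ i ∈ P, g1 i ∈ P' := fun i hi => hsw _ _ _ (hg α hα) hα' (hg i hi)
  have hg1i : InjOn g1 P := fun i hi j hj hij => hgi hi hj ((Equiv.swap _ _).injective hij)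
  have hg1α : g1 α = α' := Equiv.swap_apply_left _ _
  refine ⟨fun i => Equiv.swap (g1 β) β' (g1 i), 
    fun i hi j hj hij => hg1i hi hj ((Equiv.swap _ _).injective hij),
    fun i hi => hsw _ _ _ (hg1 β hβ) hβ' (hg1 i hi), ?_, Equiv.swap_apply_left _ _⟩
  by_cases hab : α = β
  · have := h.1 hab
    subst hab this
    exact Equiv.swap_apply_left _ _
  · have h1 : α' ≠ g1 β := fun hh => hab (hg1i hα hβ (hg1α.trans hh))
    have h2 : α' ≠ β' := fun hh => hab (h.2 hh)
    simp only [hg1α]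
    exact Equiv.swap_apply_of_ne_of_ne h1 h2

theorem ColorsOn.comp {G : SimpleGraph V} {S : Set V} {P P' : Finset ℕ} {f : V → ℕ}
    (hf : ColorsOn G S P f) {σ : ℕ → ℕ} (hσ : InjOn σ P) (hσ' : ∀ i ∈ P, σ i ∈ P') :
    ColorsOn G S P' (σ ∘ f) :=
  ⟨fun v hv => hσ' _ (hf.1 v hv),
    fun u hu v hv ha h => hf.2 u hu v hv ha (hσ (hf.1 u hu) (hf.1 v hv) h)⟩

theorem TypedColorable.recolor {G : SimpleGraph V} {Z A B : Set V} {P P' : Finset ℕ}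
    {α β α' β' : ℕ} (h : TypedColorable G Z A B P α β)
    (hc : P.card ≤ P'.card) (hα : α ∈ P)
    (hβ : β ∈ P) (hα' : α' ∈ P') (hβ' : β' ∈ P') (hab : α = β ↔ α' = β') :
    TypedColorable G Z A B P' α' β' := by
  obtain ⟨σ, h1, h2, h3, h4⟩ := exists_recolor hc hα hβ hα' hβ' hab
  obtain ⟨f, hf, hfa, hfb⟩ := h
  refine ⟨σ ∘ f, hf.comp h1 h2, fun v hv hvA hh => hfa v hv hvA (h1 (hf.1 v hv) hα ?_),
    fun v hv hvB hh => hfb v hv hvB (h1 (hf.1 v hv) hβ ?_)⟩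
  · rw [h3]; exact hh
  · rw [h4]; exact hh

/-- A twofold linked set without a suitable colouring contains paths between its two ends of many
consecutive lengths. -/
theorem TwoLinked.exists_paths [Finite V] {G : SimpleGraph V} (Z : Set V) {A B : Set V}
    {C : Finset ℕ} {α β : ℕ} (hZ : TwoLinked G Z A B) (hα : α ∈ C) (hβ : β ∈ C)
    (hcol : ¬ TypedColorable G Z A B C α β) :
    ∃ p, ∀ i < C.card - 1, ∃ l, IsPathList G Z A B l ∧ l.length = p + i := by
  classical
  induction Z using WellFoundedLT.induction generalizing A B C α β with
  | _ Z ih =>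
  have hZne : Z.Nonempty := by
    by_contra h
    rw [Set.not_nonempty_iff_eq_empty] at h
    subst h
    exact hcol ⟨fun _ => 0, by simp [ColorsOn], by simp, by simp⟩
  set m := C.card with hm
  have hm0 : 0 < m := Finset.card_pos.2 ⟨α, hα⟩
  obtain ⟨r, hr, hd⟩ := exists_rank hZ
  obtain ⟨Φ, hΦ, hΦp⟩ := exists_height (G := G) (A := A ∩ Z) (hr.mono Set.inter_subset_right)
  by_cases hbig : ∃ w ∈ A ∩ Z, m - 1 ≤ Φ w
  · obtain ⟨w, hw, hwm⟩ := hbig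
    obtain ⟨ρ, hρ1, hρ2, hρ3⟩ := exists_descending hd w hw.2
    have hpw := pairwise_of_chain hρ1
    refine ⟨ρ.length + 1, fun i hi => ?_⟩
    obtain ⟨a, ha1, ha2, ha3, ha4, ha5, ha6⟩ := (hΦp w hw).2 (i + 1) (by omega) (by omega)
    have ha0 : a ≠ [] := by rintro rfl; simp at ha1
    have hlast : a.getLast? = some w := by
      rw [List.getLast?_eq_getLast_of_ne_nil ha0]
      exact congrArg _ (ha6 _ (by rw [List.getLast?_eq_getLast_of_ne_nil ha0]; rfl))
    refine ⟨a ++ ρ, ⟨by simp [ha0], ?_, ?_, ?_, ?_, ?_⟩, by rw [List.length_append, ha1]; omega⟩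
    · refine List.nodup_append.2 ⟨ha4, (List.pairwise_cons.1 hpw).2.imp fun h1 h2 => by
        subst h2; exact lt_irrefl _ h1, fun x hx y hy h => ?_⟩
      subst h
      exact (ha3 x hx).not_gt ((List.pairwise_cons.1 hpw).1 x hy)
    · refine List.isChain_append.2 ⟨ha5, (List.isChain_cons.1 hρ1).2.imp fun _ _ h => h.1,
        fun x hx y hy => ?_⟩
      rw [ha6 x hx]
      exact ((List.isChain_cons.1 hρ1).1 y hy).1
    · intro v hv
      rcases List.mem_append.1 hv with hv | hv
      · exact (ha2 v hv).2
      · exact hρ2 v (by simp [hv])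
    · intro x hx
      obtain ⟨z, a', rfl⟩ := List.exists_cons_of_ne_nil ha0
      simp at hx
      subst hx
      exact (ha2 z (by simp)).1
    · intro x hx
      apply hρ3 x
      rw [List.getLast?_append] at hx
      cases h : ρ.getLast? with
      | none =>
        have : ρ = [] := List.getLast?_eq_none_iff.1 h
        subst this
        simpa [hlast] using hx
      | some z =>
        rw [h] at hx
        rw [List.getLast?_cons, h]
        simpa using hx
  · push Not at hbig
    set α' := if α = β then 0 else m - 1 with hα'
    have hAB : 1 < m ∨ α = β := by
      by_contra! hh
      exact hh.2 (Finset.card_le_one.1 (by omega) α hα β hβ)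
    have hcol' : ¬ TypedColorable G Z A B (Finset.range m) α' 0 := by
      refine fun h => hcol (h.recolor (by simp [hm]) ?_ ?_ hα hβ ?_)
      · simp only [hα', Finset.mem_range]; split_ifs <;> omega
      · simpa using hm0
      · simp only [hα']
        split_ifs with h
        · simp [h]
        · have := hAB.resolve_right h
          simp only [h, iff_false]; omega
    obtain ⟨P0, ρ0, γ0, hγ0, hP0, hbad0⟩ := exists_gated (m := m) hZ hr hd hΦ
      (fun w hw => ⟨(hΦp w hw).1, by have := hbig w hw; have := (hΦp w hw).1; omega⟩) hm0
      (by simp only [hα']; split_ifs <;> simp) hcol'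
    obtain ⟨P, ⟨ρ, γ, hγ, hP, hbad⟩, hPmin⟩ := Set.Finite.exists_minimal
      (s := {P : Set V | ∃ ρ γ, γ < m ∧ Gated G Z (A ∩ Z) B r P ρ γ ∧
        ¬ ∃ f, Fits G (A ∩ Z) B Φ m P ρ γ f}) (Set.toFinite _) ⟨P0, ρ0, γ0, hγ0, hP0, hbad0⟩
    have hmin : ∀ P' ⊂ P, ∀ ρ' γ', γ' < m → Gated G Z (A ∩ Z) B r P' ρ' γ' →
        ∃ f, Fits G (A ∩ Z) B Φ m P' ρ' γ' f := fun P' hP' ρ' γ' h1 h2 =>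
      by_contra fun h => hP'.2 (hPmin ⟨ρ', γ', h1, h2, h⟩ hP'.1)
    obtain ⟨w, ⟨hwA, hwρ, q, hq, ha⟩, hwmax⟩ := Set.exists_max_image
      {w | w ∈ A ∩ Z ∧ w ∉ ρ.head? ∧ ∃ p ∈ P, G.Adj p w} Φ (Set.toFinite _) (by
        obtain ⟨e, he, hx⟩ := hP.linked P subset_rfl hP.nonempty (.inr false)
        rcases e with v | (_ | _)
        · exact absurd hx.1 hx.2.1
        · exact absurd rfl he
        · obtain ⟨q, hq, w, hw, hwh, ha⟩ := hx
          exact ⟨w, hw, hwh, q, hq, ha⟩)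
    set c := Φ w with hc
    have hcm : c < m - 1 := hbig w hwA
    have hc1 : 1 ≤ c := (hΦp w hwA).1
    set S : Set V := {p | ∃ w ∈ A ∩ Z, w ∉ ρ.head? ∧ G.Adj p w ∧ Φ w = c} with hS
    have hSa : S ⊆ attach G (A ∩ Z) ρ := fun p ⟨w, h1, h2, h3, _⟩ => ⟨w, h1, h2, h3⟩
    have hlink := hP.twoLinked hbad hγ hmin hSa ⟨q, ⟨w, hwA, hwρ, ha, rfl⟩, hq⟩
    set D : Finset ℕ := insert 0 (Finset.Ico c m) with hD
    have hDc : D.card = m - c + 1 := by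
      rw [hD, Finset.card_insert_of_notMem (by simp; omega), Nat.card_Ico]
    have hncol : ¬ TypedColorable G P S (target G B ρ) D c (if γ ∈ D then γ else 0) := by
      rintro ⟨f, hf1, hf2, hf3⟩
      refine hbad ⟨f, ⟨fun v hv => ?_, hf1.2⟩, fun p hp w' hw' hh ha' => ?_, fun p hp ht => ?_⟩
      · have := hf1.1 v hv
        simp only [hD, Finset.mem_insert, Finset.mem_Ico, Finset.mem_range] at this ⊢; omega
      · intro hfe
        have h1 := hwmax w' ⟨hw', hh, p, hp, ha'⟩
        have h2 := (hΦp w' hw').1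
        have h3 := hf1.1 p hp
        simp only [hD, Finset.mem_insert, Finset.mem_Ico] at h3
        have h4 : Φ w' = c := by omega
        exact hf2 p hp ⟨w', hw', hh, ha', h4⟩ (hfe.trans h4)
      · intro hfe
        have := hf1.1 p hp
        rw [hfe] at this
        exact hf3 p hp ht (by rw [if_pos this, hfe])
    obtain ⟨p, hp⟩ := ih P (lt_of_le_of_ne hP.sub fun h => hP.notMem w (h ▸ hwA.2) hwA) hlink
      (by simp only [hD, Finset.mem_insert, Finset.mem_Ico]; omega)
      (by split_ifs with h; exacts [h, by simp [hD]]) hncol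
    refine ⟨p + 1 + ρ.length, fun i hi => ?_⟩
    obtain ⟨j, k, hj, hk, hijk⟩ : ∃ j k, j < c ∧ k < m - c ∧ i = j + k := by
      by_cases h : i < m - c
      · exact ⟨0, i, by omega, h, by simp⟩
      · exact ⟨i - (m - c - 1), m - c - 1, by omega, by omega, by omega⟩
    obtain ⟨l, hl, hlen⟩ := hp k (by omega)
    obtain ⟨x, l', rfl⟩ := List.exists_cons_of_ne_nil hl.ne_nil
    obtain ⟨w', hw', hwρ', hwa', hwc'⟩ := hl.head x (by simp)
    obtain ⟨a, ha1, ha2, ha3, ha4, ha5, ha6⟩ := (hΦp w' hw').2 (j + 1) (by omega) (by omega)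
    refine ⟨_, hP.extend hl hw' hwρ' (by simpa using hwa') (by rintro rfl; simp at ha1) ha2 ha3 ha4
      ha5 ha6, ?_⟩
    rw [List.length_append, List.length_append, ha1, hlen]
    omega

/-- `l` lists the vertices of a cycle in their cyclic order. -/
structure IsCycleList (G : SimpleGraph V) (l : List V) : Prop where
  nodup : l.Nodup
  chain : l.IsChain G.Adj
  closes : ∀ a ∈ l.head?, ∀ b ∈ l.getLast?, G.Adj b a
  three : 3 ≤ l.length

/-- A list of consecutively adjacent vertices is the support of a walk. -/
theorem exists_walk {G : SimpleGraph V} {l : List V} {a b : V} (h : l.IsChain G.Adj)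
    (ha : l.head? = some a) (hb : l.getLast? = some b) : ∃ p : G.Walk a b, p.support = l := by
  have hne : l ≠ [] := by rintro rfl; simp at ha
  obtain rfl : l.head hne = a := by rw [List.head?_eq_some_head hne] at ha; simpa using ha
  obtain rfl : l.getLast hne = b := by
    rw [List.getLast?_eq_getLast_of_ne_nil hne] at hb; simpa using hb
  exact ⟨SimpleGraph.Walk.ofSupport l hne h, SimpleGraph.Walk.support_ofSupport hne h⟩

theorem IsCycleList.hasCycleLength {G : SimpleGraph V} {l : List V} (h : IsCycleList G l) :
    HasCycleLength G l.length := by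
  obtain ⟨hn, hc, hcl, h3⟩ := h
  rcases l with _ | ⟨a, _ | ⟨b, l⟩⟩
  · simp at h3
  · simp at h3
  have hl : l ≠ [] := by rintro rfl; simp at h3
  obtain ⟨z, hz⟩ : ∃ z, l.getLast? = some z := ⟨_, List.getLast?_eq_getLast_of_ne_nil hl⟩
  have hz2 : (b :: l).getLast? = some z := by
    obtain ⟨l', rfl⟩ := List.getLast?_eq_some_iff.1 hz
    rw [← List.cons_append, List.getLast?_append]; simp
  have hz' : (a :: b :: l).getLast? = some z := by rw [List.getLast?_cons_cons, hz2]
  have hadj : G.Adj z a := hcl a (by simp) _ hz'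
  obtain ⟨hab, hbl⟩ := List.isChain_cons_cons.1 hc
  obtain ⟨p, hp⟩ := exists_walk (G := G) (l := b :: l) (a := b) hbl rfl hz2
  have hlen : p.length = l.length := by simpa [hp] using p.length_support.symm
  refine ⟨_, SimpleGraph.Walk.cons hadj (SimpleGraph.Walk.cons hab p), ?_, by simp [hlen]⟩
  rw [List.nodup_cons] at hn
  rw [SimpleGraph.Walk.cons_isCycle_iff, SimpleGraph.Walk.cons_isPath_iff, hp,
    SimpleGraph.Walk.isPath_def, hp]
  refine ⟨⟨hn.2, hn.1⟩, ?_⟩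
  rw [SimpleGraph.Walk.edges_cons, List.mem_cons]
  rintro (h | h)
  · rcases Sym2.eq_iff.1 h with ⟨h1, -⟩ | ⟨h1, -⟩
    · exact absurd h1 hadj.ne
    · exact (List.nodup_cons.1 hn.2).1 (h1 ▸ List.mem_of_getLast? hz)
  · have := SimpleGraph.Walk.snd_mem_support_of_mem_edges _ h
    rw [hp] at this
    exact hn.1 this

/-- Closing a path through `Z` to a cycle. -/
theorem IsPathList.isCycleList {G : SimpleGraph V} {Z : Set V} {x y : V} {l m : List V}
    (hl : IsPathList G Z {v | G.Adj x v} {v | G.Adj y v} l) (hm : m.Nodup)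
    (hc : m.IsChain G.Adj) (hy : m.head? = some y) (hx : m.getLast? = some x)
    (hd : ∀ v ∈ m, v ∉ Z) (h2 : 2 ≤ m.length) : IsCycleList G (l ++ m) := by
  refine ⟨List.nodup_append.2 ⟨hl.nodup, hm, ?_⟩, List.isChain_append.2 ⟨hl.chain, hc, ?_⟩, ?_, ?_⟩
  · rintro a ha b hb rfl
    exact hd a hb (hl.mem a ha)
  · intro a ha b hb
    rw [hy] at hb
    obtain rfl : y = b := by simpa using hb
    exact (hl.last a ha).symm
  · intro a ha b hb
    rw [List.head?_append_of_ne_nil _ hl.ne_nil] at ha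
    rw [List.getLast?_append, hx] at hb
    obtain rfl : x = b := by simpa using hb
    exact hl.head a ha
  · have := List.length_pos_of_ne_nil hl.ne_nil
    simp; omega

/-- `TwoLinked.exists_paths` without the assumption that the colours belong to the palette. -/
theorem TwoLinked.exists_paths_of_colors [Finite V] {G : SimpleGraph V} {Z A B : Set V}
    {C : Finset ℕ} {α β : ℕ} (hZ : TwoLinked G Z A B)
    (hcol : ¬ TypedColorable G Z A B C α β) :
    ∃ p, ∀ i < C.card - 1, ∃ l, IsPathList G Z A B l ∧ l.length = p + i := by
  rcases C.eq_empty_or_nonempty with rfl | ⟨c, hc⟩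
  · exact ⟨0, by simp⟩
  · refine TwoLinked.exists_paths Z (C := C) (α := if α ∈ C then α else c)
      (β := if β ∈ C then β else c) hZ (by split_ifs <;> assumption) (by split_ifs <;> assumption) ?_
    rintro ⟨f, hf, h1, h2⟩
    refine hcol ⟨f, hf, fun v hv hA h => ?_, fun v hv hB h => ?_⟩
    · have h3 : α ∈ C := h ▸ hf.1 v hv
      exact h1 v hv hA (by rw [if_pos h3, h])
    · have h3 : β ∈ C := h ▸ hf.1 v hv
      exact h2 v hv hB (by rw [if_pos h3, h])

/-- The outer neighbourhood of a set. -/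
def nbhd (G : SimpleGraph V) (X : Set V) : Set V := {w | w ∉ X ∧ ∃ x ∈ X, G.Adj x w}

/-- `D` is connected, in the sense that it has no proper part without edges to the rest. -/
def Conn (G : SimpleGraph V) (D : Set V) : Prop :=
  ∀ R ⊆ D, R.Nonempty → (∀ u ∈ R, ∀ v ∈ D \ R, ¬ G.Adj u v) → R = D

/-- The part of `S` that can be reached from `a`. -/
theorem exists_component [Finite V] (G : SimpleGraph V) {S : Set V} {a : V} (ha : a ∈ S) :
    ∃ X ⊆ S, a ∈ X ∧ Conn G X ∧ ∀ u ∈ X, ∀ v ∈ S \ X, ¬ G.Adj u v := by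
  obtain ⟨X, hX⟩ := Set.Finite.exists_minimal (s := {X : Set V | X ⊆ S ∧ a ∈ X ∧
    ∀ u ∈ X, ∀ v ∈ S \ X, ¬ G.Adj u v}) (Set.toFinite _) ⟨S, Subset.rfl, ha, by simp⟩
  obtain ⟨⟨hXS, haX, hcl⟩, hmin⟩ := hX
  refine ⟨X, hXS, haX, fun R hR hne hcR => ?_, hcl⟩
  by_cases haR : a ∈ R
  · refine hR.antisymm (hmin ⟨hR.trans hXS, haR, fun u hu v hv ha => ?_⟩ hR)
    by_cases hvX : v ∈ X
    · exact hcR u hu v ⟨hvX, hv.2⟩ ha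
    · exact hcl u (hR hu) v ⟨hv.1, hvX⟩ ha
  · exfalso
    have h1 : X ⊆ X \ R := hmin ⟨sdiff_subset.trans hXS, ⟨haX, haR⟩, fun u hu v hv ha => by
      by_cases hvX : v ∈ X
      · exact hcR v (by_contra fun h => hv.2 ⟨hvX, h⟩) u hu ha.symm
      · exact hcl u hu.1 v ⟨hv.1, hvX⟩ ha⟩ sdiff_subset
    obtain ⟨r, hr⟩ := hne
    exact (h1 (hR hr)).2 hr

/-- Any two vertices of a connected set are joined by a path in it. -/
theorem Conn.exists_path [Finite V] {G : SimpleGraph V} {X T : Set V} {a : V} (hX : Conn G X)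
    (ha : a ∈ X) (hT : (T ∩ X).Nonempty) : ∃ l, IsPathList G X {a} T l := by
  obtain ⟨l, h1, h2, h3, h4⟩ := exists_path_avoiding (Q := ∅) (T := T) (b := a) (by simpa) hX
    (empty_subset _) (by simp) (by simpa)
  exact ⟨a :: l, by simp, h1, h2, fun v hv => (h3 v hv).1, by simp, h4⟩

/-- If all sets meeting `Z₀` have two exits, then `Z₀` extends to a two-linked set. -/
theorem exists_twoLinked [Finite V] {G : SimpleGraph V} {D Z₀ A B : Set V} (h0 : Z₀ ⊆ D)
    (h : ∀ Q ⊆ D, (Q ∩ Z₀).Nonempty → ∀ e, ∃ e', e' ≠ e ∧ Exit G D A B Q e') :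
    ∃ Z, Z₀ ⊆ Z ∧ Z ⊆ D ∧ TwoLinked G Z A B := by
  obtain ⟨Z, hZ⟩ := Set.Finite.exists_minimal (s := {Z : Set V | Z₀ ⊆ Z ∧ Z ⊆ D ∧
    ∀ Q ⊆ Z, (Q ∩ Z₀).Nonempty → ∀ e, ∃ e', e' ≠ e ∧ Exit G Z A B Q e'}) (Set.toFinite _)
    ⟨D, h0, Subset.rfl, h⟩
  obtain ⟨⟨hZ0, hZD, hZ⟩, hmin⟩ := hZ
  refine ⟨Z, hZ0, hZD, fun Q hQ hne e => ?_⟩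
  by_contra hcon
  push Not at hcon
  have hQ0 : ¬ (Q ∩ Z₀).Nonempty := fun hh => by
    obtain ⟨e', h1, h2⟩ := hZ Q hQ hh e
    exact hcon e' h1 h2
  have key : Z ⊆ Z \ Q := by
    refine hmin ⟨fun z hz => ⟨hZ0 hz, fun hzQ => hQ0 ⟨z, hzQ, hz⟩⟩, sdiff_subset.trans hZD, ?_⟩
      sdiff_subset
    intro R hR hR0 e'
    by_contra hcon'
    push Not at hcon'
    by_cases hv : ∃ v ∈ R, e = .inl v
    · obtain ⟨v, hvR, rfl⟩ := hv
      obtain ⟨e'', h1, h2⟩ := hZ (R ∪ Q) (union_subset (hR.trans sdiff_subset) hQ)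
        (hR0.mono (inter_subset_inter_left _ subset_union_left)) e'
      rcases e'' with w | b
      · obtain ⟨hw, hwn, q, hq, ha⟩ := h2
        simp only [mem_union, not_or] at hwn
        rcases hq with hq | hq
        · exact hcon' (.inl w) h1 ⟨⟨hw, hwn.2⟩, hwn.1, q, hq, ha⟩
        · refine hcon (.inl w) ?_ ⟨hw, hwn.2, q, hq, ha⟩
          rintro h; exact hwn.1 (Sum.inl.inj h ▸ hvR)
      · rcases b <;> obtain ⟨q, hq | hq, ha⟩ := h2
        · exact hcon' _ h1 ⟨q, hq, ha⟩
        · exact hcon (.inr false) (by simp) ⟨q, hq, ha⟩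
        · exact hcon' _ h1 ⟨q, hq, ha⟩
        · exact hcon (.inr true) (by simp) ⟨q, hq, ha⟩
    · obtain ⟨e'', h1, h2⟩ := hZ R (hR.trans sdiff_subset) hR0 e'
      refine hcon' e'' h1 ?_
      rcases e'' with w | b
      · obtain ⟨hw, hwn, q, hq, ha⟩ := h2
        refine ⟨⟨hw, fun hwQ => ?_⟩, hwn, q, hq, ha⟩
        refine hcon (.inl q) (fun h => hv ⟨q, hq, h.symm⟩)
          ⟨(hR hq).1, (hR hq).2, w, hwQ, ha.symm⟩
      · rcases b <;> exact h2
  obtain ⟨q, hq⟩ := hne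
  exact (key (hQ hq)).2 hq

/-- Gluing two colourings whose domains share at most the vertex `s`. -/
theorem exists_glue_at {G : SimpleGraph V} {P₁ P₂ : Set V} {C : Finset ℕ} {f g : V → ℕ} {s : V}
    (hf : ColorsOn G P₁ C f) (hg : ColorsOn G P₂ C g) (hs : P₁ ∩ P₂ ⊆ {s})
    (he : ∀ u ∈ P₁ \ P₂, ∀ v ∈ P₂ \ P₁, ¬ G.Adj u v) :
    ∃ f', ColorsOn G (P₁ ∪ P₂) C f' ∧ ∀ v ∈ P₁, f' v = f v := by
  classical
  obtain ⟨σ, h1, h2, h3⟩ : ∃ σ : ℕ → ℕ, InjOn σ C ∧ (∀ i ∈ C, σ i ∈ C) ∧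
      ∀ v ∈ P₁ ∩ P₂, σ (g v) = f v := by
    by_cases h : s ∈ P₁ ∩ P₂
    · obtain ⟨σ, h1, h2, h3, -⟩ := exists_recolor le_rfl (hg.1 s h.2) (hg.1 s h.2) (hf.1 s h.1)
        (hf.1 s h.1) (by simp)
      refine ⟨σ, h1, h2, fun v hv => ?_⟩
      rw [hs hv, h3]
    · exact ⟨id, injOn_id _, by simp, fun v hv => absurd (hs hv ▸ hv) h⟩
  have hg' := hg.comp h1 h2
  refine ⟨fun v => if v ∈ P₁ then f v else σ (g v), ?_, fun v hv => by simp [hv]⟩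
  have hP : (P₁ ∪ P₂) ∩ P₁ = P₁ := inter_eq_right.2 subset_union_left
  have hP' : (P₁ ∪ P₂) \ P₁ = P₂ \ P₁ := by ext; simp
  refine ColorsOn.glue (f := σ ∘ g) (g := f) ?_ ?_ ?_
  · rw [hP']
    exact ⟨fun v hv => hg'.1 v hv.1, fun u hu v hv => hg'.2 u hu.1 v hv.1⟩
  · rwa [hP]
  · rw [hP, hP']
    intro u hu v hv ha
    by_cases h : u ∈ P₂
    · rw [← h3 u ⟨hu, h⟩]
      exact hg'.2 u h v hv.1 ha
    · exact absurd ha (he u ⟨hu, h⟩ v hv)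

/-- `G` is a vertex-critical graph, not `k`-colourable, and without `k` cycles of consecutive
lengths. -/
structure Critical (G : SimpleGraph V) (k : ℕ) : Prop where
  six : 6 ≤ k
  not_colorable : ¬ ∃ f, ColorsOn G univ (Finset.range k) f
  colorable : ∀ S, S ≠ univ → ∃ f, ColorsOn G S (Finset.range k) f
  no_cycles : ¬ ∃ ℓ, ∀ i < k, HasCycleLength G (ℓ + i)

theorem IsPathList.closeUp {G : SimpleGraph V} {Z : Set V} {x y : V} {l : List V}
    (hl : IsPathList G Z {v | G.Adj x v} {v | G.Adj y v} l) (hx : x ∉ Z) (hy : y ∉ Z)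
    (hxy : x ≠ y) : (y :: (l.reverse ++ [x])).Nodup ∧ (y :: (l.reverse ++ [x])).IsChain G.Adj := by
  constructor
  · simp only [List.nodup_cons, List.mem_append, List.mem_reverse, List.mem_singleton, not_or,
      List.nodup_append, List.nodup_reverse]
    refine ⟨⟨fun h => hy (hl.mem y h), hxy.symm⟩, hl.nodup, by simp, ?_⟩
    rintro a ha b rfl rfl
    exact hx (hl.mem _ ha)
  · rw [List.isChain_cons, List.isChain_append, List.isChain_reverse]
    refine ⟨?_, hl.chain.imp fun _ _ h => h.symm, by simp, ?_⟩
    · intro z hz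
      rw [List.head?_append_of_ne_nil _ (by simpa using hl.ne_nil), List.head?_reverse] at hz
      exact hl.last z hz
    · intro a ha b hb
      rw [List.getLast?_reverse] at ha
      obtain rfl : x = b := by simpa using hb
      exact (hl.head a ha).symm

section

variable [Finite V] {G : SimpleGraph V} {k : ℕ}

/-- If all neighbourhoods of subsets of `X` are large, `X` contains paths of many lengths. -/
theorem Critical.exists_paths_of_nbhd (hG : Critical G k) {X S : Set V} {x y : V}
    (hX : X.Nonempty) (hx : x ∉ X) (hy : y ∉ X) (hS : nbhd G X ⊆ insert x (insert y S))
    (hmin : ∀ Q ⊆ X, Q.Nonempty → S.ncard + 2 ≤ (nbhd G Q).ncard) :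
    ∃ p, ∀ i < k - S.ncard - 1, ∃ l, IsPathList G X {v | G.Adj x v} {v | G.Adj y v} l ∧
      l.length = p + i := by
  classical
  have hS' : ∀ u ∈ X, ∀ v, v ∉ X → G.Adj u v → v ≠ x → v ≠ y → v ∈ S := fun u hu v hv ha h1 h2 =>
    ((hS ⟨hv, u, hu, ha⟩).resolve_left h1).resolve_left h2
  have hlink : TwoLinked G X {v | G.Adj x v} {v | G.Adj y v} := by
    intro Q hQ hne e
    by_contra hcon
    push Not at hcon
    obtain ⟨p, hp⟩ : ∃ p, nbhd G Q ⊆ insert p S := by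
      refine ⟨match e with | .inl w => w | .inr true => x | .inr false => y, ?_⟩
      rintro w ⟨hwQ, q, hq, ha⟩
      by_cases hwX : w ∈ X
      · have h := by_contra fun h => hcon (.inl w) h ⟨hwX, hwQ, q, hq, ha⟩
        subst h; simp
      by_cases hwx : w = x
      · subst hwx
        have h := by_contra fun h => hcon (.inr true) h ⟨q, hq, ha.symm⟩
        subst h; simp
      by_cases hwy : w = y
      · subst hwy
        have h := by_contra fun h => hcon (.inr false) h ⟨q, hq, ha.symm⟩
        subst h; simp
      · exact Or.inr (hS' q (hQ hq) w hwX ha hwx hwy)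
    have h1 := hmin Q hQ hne
    have h2 := (Set.ncard_le_ncard hp).trans (Set.ncard_insert_le p S)
    omega
  obtain ⟨ψ, hψ⟩ := hG.colorable Xᶜ (by simpa using hX.ne_empty)
  set C := Finset.range k \ (S.toFinite.toFinset.image ψ) with hC
  have hCc : k - S.ncard ≤ C.card := by
    have h1 := Finset.le_card_sdiff (S.toFinite.toFinset.image ψ) (Finset.range k)
    have h2 := Finset.card_image_le (s := S.toFinite.toFinset) (f := ψ)
    rw [← Set.ncard_eq_toFinset_card] at h2
    rw [Finset.card_range, ← hC] at h1
    omega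
  obtain ⟨p, hp⟩ := hlink.exists_paths_of_colors (C := C) (α := ψ x) (β := ψ y) (by
    rintro ⟨g, hg, hgx, hgy⟩
    refine hG.not_colorable ⟨_, ColorsOn.glue (Q := X) (f := ψ) (g := g) ?_ ?_ ?_⟩
    · rwa [← compl_eq_univ_sdiff]
    · rw [univ_inter]
      exact ⟨fun v hv => (Finset.mem_sdiff.1 (hg.1 v hv)).1, hg.2⟩
    · rintro u ⟨-, hu⟩ v ⟨-, hv⟩ ha
      by_cases hvx : v = x
      · subst hvx; exact hgx u hu ha.symm
      by_cases hvy : v = y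
      · subst hvy; exact hgy u hu ha.symm
      · have hvS := hS' u hu v hv ha hvx hvy
        intro h
        refine (Finset.mem_sdiff.1 (hg.1 u hu)).2 (Finset.mem_image.2 ⟨v, by simpa using hvS, h.symm⟩))
  exact ⟨p, fun i hi => hp i (by omega)⟩

/-- One side of a smallest separator provides paths of many lengths. -/
theorem Critical.exists_paths_side (hG : Critical G k) {X : Set V} {x y : V}
    (hx : x ∈ nbhd G X) (hy : y ∈ nbhd G X) (hxy : x ≠ y) (h3 : (nbhd G X).ncard ≤ 3)
    (hXne : X.Nonempty) (hX : ∃ y, y ∉ X ∪ nbhd G X)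
    (hmin : ∀ Q : Set V, Q.Nonempty → (∃ y, y ∉ Q ∪ nbhd G Q) →
      (nbhd G X).ncard ≤ (nbhd G Q).ncard) :
    ∃ p, ∀ i < k - 2, ∃ l, IsPathList G X {v | G.Adj x v} {v | G.Adj y v} l ∧
      l.length = p + i := by
  have hcard : (nbhd G X \ {x, y}).ncard + 2 = (nbhd G X).ncard := by
    rw [← Set.ncard_pair hxy, Set.ncard_sdiff_add_ncard_of_subset]
    rintro z (rfl | rfl) <;> assumption
  obtain ⟨p, hp⟩ := hG.exists_paths_of_nbhd (S := nbhd G X \ {x, y}) hXne hx.1 hy.1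
    (fun v hv => by
      by_cases h1 : v = x
      · exact Or.inl h1
      by_cases h2 : v = y
      · exact Or.inr (Or.inl h2)
      exact Or.inr (Or.inr ⟨hv, by simp [h1, h2]⟩)) (by
      intro Q hQ hne
      obtain ⟨z, hz⟩ := hX
      rw [hcard]
      refine hmin Q hne ⟨z, fun h => hz ?_⟩
      rcases h with h | ⟨-, q, hq, ha⟩
      · exact Or.inl (hQ h)
      · by_cases hzX : z ∈ X
        · exact Or.inl hzX
        · exact Or.inr ⟨hzX, q, hQ hq, ha⟩)
  exact ⟨p, fun i hi => hp i (by omega)⟩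

/-- The graph has no separator with at most three vertices. -/
theorem Critical.four_le_ncard_nbhd (hG : Critical G k) {X : Set V} (hX : X.Nonempty)
    (hX' : ∃ y, y ∉ X ∪ nbhd G X) : 4 ≤ (nbhd G X).ncard := by
  classical
  by_contra! hlt
  obtain ⟨X₀, ⟨hX₀, hX₀'⟩, hmin⟩ := Set.exists_min_image
    {X : Set V | X.Nonempty ∧ ∃ y, y ∉ X ∪ nbhd G X} (fun X => (nbhd G X).ncard)
    (Set.toFinite _) ⟨X, hX, hX'⟩
  have h3 : (nbhd G X₀).ncard ≤ 3 := (hmin X ⟨hX, hX'⟩).trans (by omega)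
  clear hlt hX' hX X
  rename' X₀ => X, hX₀ => hX, hX₀' => hX'
  have hk := hG.six
  rcases le_or_gt (nbhd G X).ncard 1 with h1 | h2
  · obtain ⟨y, hy⟩ := hX'
    have : Nonempty V := ⟨y⟩
    obtain ⟨s, hs⟩ := (Set.ncard_le_one_iff_subset_singleton (Set.toFinite _)).1 h1
    obtain ⟨f, hf⟩ := hG.colorable Xᶜ (by simpa using hX.ne_empty)
    obtain ⟨g, hg⟩ := hG.colorable (X ∪ nbhd G X) (fun h => hy (h ▸ mem_univ y))
    obtain ⟨f', hf', -⟩ := exists_glue_at (s := s) hf hg (by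
      rintro v ⟨hv, hv' | hv'⟩
      · exact absurd hv' hv
      · exact hs hv') (by
      rintro u ⟨hu, hu'⟩ v ⟨-, hv⟩ ha
      have hvX : v ∈ X := not_not.1 hv
      exact hu' (Or.inr ⟨hu, v, hvX, ha.symm⟩))
    refine hG.not_colorable ⟨f', ?_⟩
    rwa [← union_assoc, compl_union_self, univ_union] at hf'
  · obtain ⟨x, hx, y, hy, hxy⟩ := (Set.one_lt_ncard).1 h2
    set Y := (X ∪ nbhd G X)ᶜ with hYdef
    have hYS : nbhd G Y ⊆ nbhd G X := by
      rintro w ⟨hw, v, hv, ha⟩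
      have h := not_not.1 hw
      refine h.resolve_left fun hwX => hv (Or.inr ⟨fun hvX => hv (Or.inl hvX), w, hwX, ha.symm⟩)
    have hY' : ∃ y, y ∉ Y ∪ nbhd G Y := by
      obtain ⟨x, hx⟩ := hX
      refine ⟨x, fun h => h.elim (fun h => h (Or.inl hx)) (fun h => (hYS h).1 hx)⟩
    have hYS' : nbhd G Y = nbhd G X := Set.eq_of_subset_of_ncard_le hYS (hmin Y ⟨hX', hY'⟩)
    obtain ⟨p₁, hp₁⟩ := hG.exists_paths_side hx hy hxy h3 hX hX'
      fun Q h h' => hmin Q ⟨h, h'⟩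
    obtain ⟨p₂, hp₂⟩ := hG.exists_paths_side (X := Y) (hYS' ▸ hx) (hYS' ▸ hy) hxy (hYS' ▸ h3) hX'
      hY' (hYS' ▸ fun Q h h' => hmin Q ⟨h, h'⟩)
    refine hG.no_cycles ⟨p₁ + p₂ + 2, fun t ht => ?_⟩
    obtain ⟨l₁, hl₁, hn₁⟩ := hp₁ (min t (k - 3)) (by omega)
    obtain ⟨l₂, hl₂, hn₂⟩ := hp₂ (t - min t (k - 3)) (by omega)
    have hxY : x ∉ Y := fun h => h (Or.inr hx)
    have hyY : y ∉ Y := fun h => h (Or.inr hy)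
    obtain ⟨h4, h5⟩ := hl₂.closeUp hxY hyY hxy
    have := (hl₁.isCycleList h4 h5 rfl (by rw [← List.cons_append, List.getLast?_append]; simp) (by
      intro v hv hvX
      rcases List.mem_cons.1 hv with rfl | hv
      · exact hy.1 hvX
      rcases List.mem_append.1 hv with hv | hv
      · exact hl₂.mem v (List.mem_reverse.1 hv) (Or.inl hvX)
      · rw [List.mem_singleton.1 hv] at hvX
        exact hx.1 hvX) (by simp)).hasCycleLength
    convert this using 1
    simp
    omega

end

/-- A list describing an odd cycle of length at least five. -/
structure IsOddCycleList (G : SimpleGraph V) (l : List V) : Prop extends IsCycleList G l where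
  odd : Odd l.length
  five : 5 ≤ l.length

theorem IsPathList.mono {G : SimpleGraph V} {Z A B Z' A' B' : Set V} {l : List V}
    (h : IsPathList G Z A B l) (hZ : Z ⊆ Z') (hA : A ⊆ A') (hB : B ⊆ B') :
    IsPathList G Z' A' B' l :=
  ⟨h.ne_nil, h.nodup, h.chain, fun v hv => hZ (h.mem v hv), fun a ha => hA (h.head a ha),
    fun b hb => hB (h.last b hb)⟩

theorem IsPathList.mem_of_singleton {G : SimpleGraph V} {Z B : Set V} {a : V} {l : List V}
    (h : IsPathList G Z {a} B l) : a ∈ l := by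
  have h1 := List.head?_eq_some_head h.ne_nil
  rw [← show l.head h.ne_nil = a from h.head _ h1]
  exact List.head_mem h.ne_nil

theorem Critical.exists_adj {G : SimpleGraph V} {k : ℕ} (hG : Critical G k) :
    ∃ x y, G.Adj x y := by
  by_contra! h
  have := hG.six
  exact hG.not_colorable ⟨fun _ => 0, by simp; omega, fun u _ v _ ha => absurd ha (h u v)⟩

section

variable [Finite V] {G : SimpleGraph V} {k : ℕ}

theorem Critical.exists_oddCycle (hG : Critical G k) : ∃ l, IsOddCycleList G l := by
  classical
  obtain ⟨x, y, hxy⟩ := hG.exists_adj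
  have hk := hG.six
  have hlink : TwoLinked G {x, y}ᶜ {v | G.Adj x v} {v | G.Adj y v} := by
    intro Q hQ hne e
    by_contra hcon
    push Not at hcon
    obtain ⟨p, hp⟩ : ∃ p, nbhd G Q ⊆ {p} := by
      refine ⟨match e with | .inl w => w | .inr true => x | .inr false => y, ?_⟩
      rintro w ⟨hwQ, q, hq, ha⟩
      by_cases hwx : w = x
      · subst hwx
        have h := by_contra fun h => hcon (.inr true) h ⟨q, hq, ha.symm⟩
        subst h; simp
      by_cases hwy : w = y
      · subst hwy
        have h := by_contra fun h => hcon (.inr false) h ⟨q, hq, ha.symm⟩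
        subst h; simp
      · have h := by_contra fun h => hcon (.inl w) h ⟨by simp [hwx, hwy], hwQ, q, hq, ha⟩
        subst h; simp
    have hxQ : x ∉ Q := fun h => hQ h (by simp)
    have hyQ : y ∉ Q := fun h => hQ h (by simp)
    have h1 := hG.four_le_ncard_nbhd hne (by
      by_cases hx : x ∈ nbhd G Q
      · refine ⟨y, fun h => h.elim hyQ fun hy => hxy.ne ((hp hx).trans (hp hy).symm)⟩
      · exact ⟨x, fun h => h.elim hxQ hx⟩)
    have h2 := Set.ncard_le_ncard hp
    rw [Set.ncard_singleton] at h2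
    omega
  obtain ⟨p, hp⟩ := hlink.exists_paths_of_colors (C := Finset.range k) (α := 0) (β := 1) (by
    rintro ⟨g, hg, hgx, hgy⟩
    refine hG.not_colorable ⟨_, ColorsOn.glue (Q := {x, y}ᶜ)
      (f := fun v => if v = x then 0 else 1) (g := g) ?_ ?_ ?_⟩
    · refine ⟨fun v hv => ?_, ?_⟩
      · dsimp only
        split_ifs <;> simp <;> omega
      · rintro u ⟨-, hu⟩ v ⟨-, hv⟩ ha
        have hne := ha.ne
        have hne' := ha.ne'
        rcases not_not.1 hu with rfl | rfl <;> rcases not_not.1 hv with rfl | rfl <;>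
          simp [hne, hne'] <;> exact hne rfl
    · rwa [univ_inter]
    · rintro u ⟨-, hu⟩ v ⟨-, hv⟩ ha
      rcases not_not.1 hv with rfl | rfl
      · simpa using hgx u hu ha.symm
      · simpa [hxy.ne'] using hgy u hu ha.symm)
  have hp1 : 1 ≤ p := by
    obtain ⟨l, hl, hn⟩ := hp 0 (by rw [Finset.card_range]; omega)
    have := List.length_pos_of_ne_nil hl.ne_nil
    omega
  obtain ⟨i, hi2, hi3, hodd⟩ : ∃ i, 2 ≤ i ∧ i ≤ 3 ∧ (p + i) % 2 = 1 := by
    rcases Nat.mod_two_eq_zero_or_one p with h | h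
    · exact ⟨3, by omega, by omega, by omega⟩
    · exact ⟨2, by omega, by omega, by omega⟩
  obtain ⟨l, hl, hn⟩ := hp i (by rw [Finset.card_range]; omega)
  refine ⟨l ++ [y, x], hl.isCycleList (by simp [hxy.ne']) (by simp [hxy.symm]) (by simp) (by simp)
    (by simp) (by simp), ?_, ?_⟩
  · rw [Nat.odd_iff]; simp; omega
  · simp; omega

/-- Some odd cycle of length at least five does not induce a clique. -/
theorem Critical.exists_oddCycle_not_isClique (hG : Critical G k)
    (hnc : ∃ u v, u ≠ v ∧ ¬ G.Adj u v) :
    ∃ l, IsOddCycleList G l ∧ ¬ G.IsClique {v | v ∈ l} := by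
  classical
  obtain ⟨l₀, hl₀⟩ := hG.exists_oddCycle
  by_cases hcl : G.IsClique {v | v ∈ l₀}
  swap
  · exact ⟨l₀, hl₀, hcl⟩
  obtain ⟨K, ⟨hK, hlK⟩, hmax⟩ := Set.Finite.exists_maximal
    (s := {K : Set V | G.IsClique K ∧ {v | v ∈ l₀} ⊆ K}) (Set.toFinite _) ⟨_, hcl, Subset.rfl⟩
  have hK5 : 5 ≤ K.ncard := by
    refine hl₀.five.trans (le_trans ?_ (Set.ncard_le_ncard hlK))
    rw [← List.toFinset_card_of_nodup hl₀.nodup, ← Set.ncard_coe_finset]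
    simp
  obtain ⟨u, v, huv, hna⟩ := hnc
  obtain ⟨b, hb⟩ : ∃ b, b ∈ Kᶜ := by
    by_contra! h
    exact hna (hK (not_not.1 (h u)) (not_not.1 (h v)) huv)
  obtain ⟨X, hXK, hbX, hconn, hX⟩ := exists_component G hb
  have hN : nbhd G X ⊆ K := by
    rintro w ⟨hw, x, hx, ha⟩
    by_contra h
    exact hX x hx w ⟨h, hw⟩ ha
  have hN4 : 4 ≤ (nbhd G X).ncard := by
    by_cases h : ∃ z, z ∉ X ∪ nbhd G X
    · exact hG.four_le_ncard_nbhd ⟨b, hbX⟩ h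
    · push Not at h
      have : K ⊆ nbhd G X := fun z hz => (h z).resolve_left fun hh => hXK hh hz
      have := Set.ncard_le_ncard this
      omega
  obtain ⟨p, hp⟩ : (nbhd G X).Nonempty := by
    rw [← Set.ncard_pos]; omega
  have hpK := hN hp
  obtain ⟨-, a, haX, hap⟩ := hp
  obtain ⟨o, hoK, hao⟩ : ∃ o ∈ K, ¬ G.Adj a o := by
    by_contra! h
    refine hXK haX (hmax (y := insert a K) ⟨?_, hlK.trans (subset_insert _ _)⟩
      (subset_insert _ _) (mem_insert _ _))
    exact hK.insert fun b hb _ => h b hb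
  have hpo : p ≠ o := by rintro rfl; exact hao hap
  obtain ⟨q, hq, hqpo⟩ : ∃ q ∈ nbhd G X, q ∉ ({p, o} : Set V) := by
    refine Set.exists_mem_notMem_of_ncard_lt_ncard ?_ (Set.toFinite _)
    rw [Set.ncard_pair hpo]; omega
  simp only [mem_insert_iff, mem_singleton_iff, not_or] at hqpo
  have hqK := hN hq
  obtain ⟨-, z, hzX, hzq⟩ := hq
  obtain ⟨o', ho'K, ho'⟩ : ∃ o' ∈ K, o' ∉ ({p, o, q} : Set V) := by
    refine Set.exists_mem_notMem_of_ncard_lt_ncard ?_ (Set.toFinite _)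
    have h1 := Set.ncard_insert_le p {o, q}
    have h2 := Set.ncard_insert_le o {q}
    rw [Set.ncard_singleton] at h2
    omega
  simp only [mem_insert_iff, mem_singleton_iff, not_or] at ho'
  obtain ⟨l, hl⟩ := hconn.exists_path (T := {v | G.Adj q v}) haX ⟨z, hzq.symm, hzX⟩
  have hal := hl.mem_of_singleton
  have hl' := hl.mono Subset.rfl (show {a} ⊆ {v | G.Adj p v} by simpa using hap.symm) Subset.rfl
  have hlen := List.length_pos_of_ne_nil hl.ne_nil
  have hKX : ∀ v ∈ K, v ∉ X := fun v hv hvX => hXK hvX hv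
  have hao' : a ≠ o := fun h => hKX o hoK (h ▸ haX)
  have hqo : G.Adj q o := hK hqK hoK hqpo.2
  have hop : G.Adj o p := hK hoK hpK hpo.symm
  have hqo' : G.Adj q o' := hK hqK ho'K (Ne.symm ho'.2.2)
  have ho'o : G.Adj o' o := hK ho'K hoK ho'.2.1
  rcases Nat.even_or_odd l.length with he | he
  · refine ⟨l ++ [q, o, p], ⟨hl'.isCycleList ?_ ?_ rfl rfl ?_ (by simp), ?_, ?_⟩, fun h => ?_⟩
    · simp [hqpo, hpo.symm]
    · simp [hqo, hop]
    · simp only [List.mem_cons, List.not_mem_nil, or_false]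
      rintro v (rfl | rfl | rfl) <;> apply hKX <;> assumption
    · rw [Nat.odd_iff]; rw [Nat.even_iff] at he; simp; omega
    · rw [Nat.even_iff] at he; simp; omega
    · exact hao (h (by simp [hal]) (by simp) hao')
  · refine ⟨l ++ [q, o', o, p], ⟨hl'.isCycleList ?_ ?_ rfl rfl ?_ (by simp), ?_, ?_⟩, fun h => ?_⟩
    · simp [hqpo, hpo.symm, ho', Ne.symm ho'.2.2]
    · simp [hqo', hop, ho'o]
    · simp only [List.mem_cons, List.not_mem_nil, or_false]
      rintro v (rfl | rfl | rfl | rfl) <;> apply hKX <;> assumption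
    · rw [Nat.odd_iff] at *; simp; omega
    · simp; omega
    · exact hao (h (by simp [hal]) (by simp) hao')

end

/-- The `m` consecutive terms of `c` starting with `c a`. -/
def arc (c : ℤ → V) (a : ℤ) (m : ℕ) : List V := (List.range m).map fun i : ℕ => c (a + i)

section arc

variable {c : ℤ → V} {a : ℤ} {m : ℕ}

@[simp] theorem length_arc : (arc c a m).length = m := by simp [arc]

theorem mem_arc {v : V} : v ∈ arc c a m ↔ ∃ i : ℤ, a ≤ i ∧ i < a + m ∧ v = c i := by
  simp only [arc, List.mem_map, List.mem_range]
  constructor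
  · rintro ⟨i, hi, rfl⟩
    exact ⟨a + i, by omega, by omega, rfl⟩
  · rintro ⟨i, h1, h2, rfl⟩
    exact ⟨(i - a).toNat, by omega, by congr 1; omega⟩

theorem head?_arc (h : 0 < m) : (arc c a m).head? = some (c a) := by
  obtain ⟨m, rfl⟩ := Nat.exists_eq_succ_of_ne_zero h.ne'
  simp [arc, List.range_succ_eq_map]

theorem getLast?_arc (h : 0 < m) : (arc c a m).getLast? = some (c (a + m - 1)) := by
  obtain ⟨m, rfl⟩ := Nat.exists_eq_succ_of_ne_zero h.ne'
  simp [arc, List.range_succ]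
  congr 1; ring

end arc

/-- An odd cycle `c` of length `n` in `U`, indexed by the integers, that is not a clique, such that
every odd cycle in `U` that is shorter or misses a vertex of `B` is a clique. -/
structure Ring (G : SimpleGraph V) (U B : Set V) (n : ℕ) (c : ℤ → V) : Prop where
  per : ∀ i, c (i + n) = c i
  inj : ∀ i j, c i = c j → (n : ℤ) ∣ j - i
  adj : ∀ i, G.Adj (c i) (c (i + 1))
  mem : ∀ i, c i ∈ U
  odd : n % 2 = 1
  five : 5 ≤ n
  not_clique : ¬ G.IsClique (range c)
  short : ∀ l, IsOddCycleList G l → (∀ v ∈ l, v ∈ U) → l.length < n → G.IsClique {v | v ∈ l}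
  miss : ∀ l, IsOddCycleList G l → (∀ v ∈ l, v ∈ U) → (∃ b ∈ B, b ∉ l) → G.IsClique {v | v ∈ l}

namespace Ring

variable {G : SimpleGraph V} {U B : Set V} {n : ℕ} {c : ℤ → V}

theorem shift (h : Ring G U B n c) (s : ℤ) : Ring G U B n fun i => c (s + i) := by
  have hr : range (fun i => c (s + i)) = range c := by
    ext v; constructor
    · rintro ⟨i, rfl⟩; exact ⟨_, rfl⟩
    · rintro ⟨i, rfl⟩; exact ⟨i - s, by simp⟩
  refine ⟨fun i => ?_, fun i j hij => ?_, fun i => ?_, fun i => h.mem _, h.odd, h.five, ?_, h.short,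
    h.miss⟩
  · rw [← add_assoc, h.per]
  · have := h.inj _ _ hij
    rwa [add_sub_add_left_eq_sub] at this
  · rw [← add_assoc]; exact h.adj _
  · rw [hr]; exact h.not_clique

theorem reflect (h : Ring G U B n c) : Ring G U B n fun i => c (-i) := by
  have hr : range (fun i => c (-i)) = range c := by
    ext v; constructor
    · rintro ⟨i, rfl⟩; exact ⟨_, rfl⟩
    · rintro ⟨i, rfl⟩; exact ⟨-i, by simp⟩
  refine ⟨fun i => ?_, fun i j hij => ?_, fun i => ?_, fun i => h.mem _, h.odd, h.five, ?_, h.short,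
    h.miss⟩
  · rw [← h.per, neg_add, neg_add_cancel_right]
  · have := h.inj _ _ hij
    rwa [← dvd_neg, show -(j - i) = -j - -i by ring]
  · have := (h.adj (-(i + 1))).symm
    rwa [show -(i + 1) + 1 = -i by ring] at this
  · rw [hr]; exact h.not_clique

theorem eq_of_window (h : Ring G U B n c) {a i j : ℤ} (hi : a ≤ i) (hi' : i < a + n) (hj : a ≤ j)
    (hj' : j < a + n) (hij : c i = c j) : i = j := by
  obtain ⟨d, hd⟩ := h.inj i j hij
  have h1 : (n : ℤ) * d < n * 1 := by omega
  have h2 : (n : ℤ) * (-1) < n * d := by omega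
  have hn : (0 : ℤ) ≤ n := by omega
  have h3 := lt_of_mul_lt_mul_left h1 hn
  have h4 := lt_of_mul_lt_mul_left h2 hn
  have : d = 0 := by omega
  subst this
  omega

theorem ne_of_window (h : Ring G U B n c) {i j : ℤ} (h1 : i < j) (h2 : j < i + n) :
    c i ≠ c j := fun hh =>
  h1.ne (h.eq_of_window (a := i) le_rfl (by have := h.five; omega) h1.le h2 hh)

theorem per_mul (h : Ring G U B n c) (i d : ℤ) : c (i + n * d) = c i := by
  induction d using Int.induction_on with
  | zero => simp
  | succ d ih => rw [← ih, ← h.per (i + n * d)]; congr 1; ring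
  | pred d ih => rw [← ih, ← h.per (i + n * (-d - 1))]; congr 1; ring

theorem exists_window (h : Ring G U B n c) (a i : ℤ) : ∃ j, a ≤ j ∧ j < a + n ∧ c j = c i := by
  have hn := h.five
  refine ⟨a + (i - a) % n, ?_, ?_, ?_⟩
  · have := Int.emod_nonneg (i - a) (show (n : ℤ) ≠ 0 by omega)
    omega
  · have := Int.emod_lt_of_pos (i - a) (show (0 : ℤ) < n by omega)
    omega
  · rw [← h.per_mul _ ((i - a) / n)]
    congr 1
    have := Int.emod_add_mul_ediv (i - a) n
    linarith

theorem nodup_arc (h : Ring G U B n c) {a : ℤ} {m : ℕ} (hm : m ≤ n) : (arc c a m).Nodup := by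
  refine List.Nodup.map_on ?_ List.nodup_range
  intro i hi j hj hij
  simp at hi hj
  have := h.eq_of_window (a := a) (by omega) (by omega) (by omega) (by omega) hij
  omega

theorem isChain_arc (h : Ring G U B n c) (a : ℤ) (m : ℕ) : (arc c a m).IsChain G.Adj := by
  rw [arc, List.isChain_map, List.isChain_iff_getElem]
  intro i hi
  simp only [List.getElem_range]
  have := h.adj (a + i)
  convert this using 2
  push_cast; ring

theorem isClique_of (h : Ring G U B n c)
    (hadj : ∀ i j : ℤ, 0 ≤ i → i < j → j < n → G.Adj (c i) (c j)) : G.IsClique (range c) := by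
  rintro _ ⟨i, rfl⟩ _ ⟨j, rfl⟩ hne
  obtain ⟨i', h1, h2, hi⟩ := h.exists_window 0 i
  obtain ⟨j', h3, h4, hj⟩ := h.exists_window 0 j
  rw [← hi, ← hj] at hne ⊢
  rcases lt_trichotomy i' j' with hl | rfl | hl
  · exact hadj _ _ h1 hl (by omega)
  · exact absurd rfl hne
  · exact (hadj _ _ h3 hl (by omega)).symm

/-- Short odd cycles induce cliques. -/
theorem adj_of_short (h : Ring G U B n c) {l : List V} (hn : l.Nodup) (hc : l.IsChain G.Adj)
    (hcl : ∀ a ∈ l.head?, ∀ b ∈ l.getLast?, G.Adj b a) (hodd : l.length % 2 = 1)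
    (h5 : 5 ≤ l.length) (hU : ∀ v ∈ l, v ∈ U) (hlt : l.length < n) {u v : V} (hu : u ∈ l)
    (hv : v ∈ l) (huv : u ≠ v) : G.Adj u v :=
  h.short l ⟨⟨hn, hc, hcl, by omega⟩, Nat.odd_iff.2 hodd, h5⟩ hU hlt hu hv huv

theorem arc_subset (h : Ring G U B n c) {a : ℤ} {m : ℕ} {v : V} (hv : v ∈ arc c a m) : v ∈ U := by
  obtain ⟨i, -, -, rfl⟩ := mem_arc.1 hv
  exact h.mem i

theorem not_adj_even (h : Ring G U B n c) (h7 : 7 ≤ n) {a : ℕ} (ha : a % 2 = 0) (h4 : 4 ≤ a)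
    (han : a + 3 ≤ n) : ¬ G.Adj (c 0) (c a) := by
  intro hadj
  have hw : ∀ {i j : ℤ}, 0 ≤ i → i < j → j < n → c i ≠ c j := fun h1 h2 h3 =>
    h.ne_of_window h2 (by omega)
  have hA : ∀ i j : ℤ, 0 ≤ i → i < j → j ≤ a → G.Adj (c i) (c j) := by
    intro i j h1 h2 h3
    refine h.adj_of_short (l := arc c 0 (a + 1)) (h.nodup_arc (by omega)) (h.isChain_arc _ _) ?_
      (by simp; omega) (by simp; omega) (fun v => h.arc_subset) (by simp; omega)
      (mem_arc.2 ⟨i, h1, by push_cast; omega, rfl⟩) (mem_arc.2 ⟨j, by omega, by push_cast; omega, rfl⟩)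
      (hw h1 h2 (by omega))
    rw [head?_arc (by omega), getLast?_arc (by omega)]
    simpa using hadj.symm
  have hc0 : c n = c 0 := by simpa using h.per 0
  have h2 : ∀ i j : ℤ, (i = 0 ∨ 3 ≤ i) → i < j → (3 ≤ j) → j < n → G.Adj (c i) (c j) := by
    intro i j h1 h2 h3 h4
    have hmem : ∀ v, v ∈ c 0 :: arc c 3 (n - 3) → v = c 0 ∨ ∃ i : ℤ, 3 ≤ i ∧ i < n ∧ v = c i := by
      intro v hv
      refine (List.mem_cons.1 hv).imp id fun hv => ?_
      obtain ⟨i, h1, h2, rfl⟩ := mem_arc.1 hv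
      exact ⟨i, h1, by omega, rfl⟩
    refine h.adj_of_short (l := c 0 :: arc c 3 (n - 3)) ?_ ?_ ?_ (by have := h.odd; simp; omega)
      (by simp; omega) ?_ (by simp; omega) ?_ (List.mem_cons_of_mem _ (mem_arc.2 ⟨j, by omega, by omega, rfl⟩))
      (hw (by omega) h2 (by omega))
    · rw [List.nodup_cons]
      refine ⟨fun hh => ?_, h.nodup_arc (by omega)⟩
      obtain ⟨i, h1, h2, h3⟩ := mem_arc.1 hh
      exact hw le_rfl (by omega) (by omega) h3
    · rw [List.isChain_cons]
      refine ⟨?_, h.isChain_arc _ _⟩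
      rw [head?_arc (by omega)]
      simpa using hA 0 3 le_rfl (by omega) (by omega)
    · rw [List.getLast?_cons, getLast?_arc (by omega)]
      simp
      have := h.adj (n - 1)
      rw [sub_add_cancel, hc0] at this
      convert this using 2
      omega
    · intro v hv
      rcases hmem v hv with rfl | ⟨i, -, -, rfl⟩ <;> exact h.mem _
    · rcases h1 with rfl | h1
      · simp
      · exact List.mem_cons_of_mem _ (mem_arc.2 ⟨i, by omega, by omega, rfl⟩)
  have h3 : ∀ i w : ℤ, (i = 1 ∨ i = 2) → 5 ≤ w → w < n → G.Adj (c i) (c w) := by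
    intro i w hi h5 hwn
    have e1 : G.Adj (c i) (c 0) := (hA 0 i le_rfl (by omega) (by omega)).symm
    have e2 : G.Adj (c 0) (c w) := h2 0 w (by simp) (by omega) (by omega) (by omega)
    have e3 : G.Adj (c w) (c 4) := (h2 4 w (by simp) (by omega) (by omega) (by omega)).symm
    have e4 : G.Adj (c 4) (c 3) := (h2 3 4 (by simp) (by omega) (by omega) (by omega)).symm
    have e5 : G.Adj (c 3) (c i) := (hA i 3 (by omega) (by omega) (by omega)).symm
    have n0 := hw (i := i) (j := w) (by omega) (by omega) (by omega)
    have n1 := hw (i := i) (j := 4) (by omega) (by omega) (by omega)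
    have n2 := hw (i := 0) (j := 4) (by omega) (by omega) (by omega)
    have n3 := hw (i := 0) (j := 3) (by omega) (by omega) (by omega)
    have n4 := hw (i := 3) (j := w) (by omega) (by omega) (by omega)
    refine h.adj_of_short (l := [c i, c 0, c w, c 4, c 3]) ?_ ?_ ?_ (by simp) (by simp) ?_
      (by simp; omega) (by simp) (by simp) n0
    · simp [e1.ne, e2.ne, e3.ne, e4.ne, e5.ne', n0, n1, n2, n3, n4.symm]
    · simp [e1, e2, e3, e4]
    · simpa using e5
    · simp [h.mem]
  apply h.not_clique
  refine h.isClique_of fun i j h0 hij hj => ?_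
  by_cases hi : i = 0 ∨ 3 ≤ i
  · by_cases hj3 : 3 ≤ j
    · exact h2 i j hi hij hj3 hj
    · exact hA i j h0 hij (by omega)
  · by_cases hj5 : 5 ≤ j
    · exact h3 i j (by omega) hj5 hj
    · exact hA i j h0 hij (by omega)

theorem not_adj (h : Ring G U B n c) (h7 : 7 ≤ n) {i j : ℤ} (h3 : i + 3 ≤ j) (hn : j + 3 ≤ i + n) :
    ¬ G.Adj (c i) (c j) := by
  intro hadj
  obtain ⟨a, ha⟩ : ∃ a : ℕ, j = i + a := ⟨(j - i).toNat, by omega⟩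
  subst ha
  have := h.odd
  rcases Nat.mod_two_eq_zero_or_one a with h2 | h2
  · refine (h.shift i).not_adj_even h7 h2 (by omega) (by omega) ?_
    simpa using hadj
  · refine (h.shift (i + a)).not_adj_even h7 (a := n - a) (by omega) (by omega) (by omega) ?_
    have e : i + a + ((n - a : ℕ) : ℤ) = i + n := by omega
    simp only [add_zero, e, h.per]
    exact hadj.symm

theorem chord_aux (h : Ring G U B n c) (h7 : 7 ≤ n) {d : ℤ} (h2 : 2 ≤ d) (hd : d + 3 ≤ n)
    (h02 : G.Adj (c 0) (c 2)) (hdd : G.Adj (c d) (c (d + 2))) : False := by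
  obtain ⟨d, rfl⟩ : ∃ d' : ℕ, d = d' := ⟨d.toNat, by omega⟩
  have hw : ∀ {i j : ℤ}, 0 ≤ i → i < j → j < n → c i ≠ c j := fun h1 h2 h3 =>
    h.ne_of_window h2 (by omega)
  have hc0 : c n = c 0 := by simpa using h.per 0
  have hodd := h.odd
  have key : ∀ v ∈ c 0 :: (arc c 2 (d - 1) ++ arc c (d + 2) (n - 2 - d)), v ≠ c 0 →
      G.Adj (c 0) v := by
    intro v hv hne
    refine h.adj_of_short (l := c 0 :: (arc c 2 (d - 1) ++ arc c (d + 2) (n - 2 - d))) ?_ ?_ ?_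
      (by simp; omega) (by simp; omega) ?_ (by simp; omega) (by simp) hv hne.symm
    · rw [List.nodup_cons, List.nodup_append]
      refine ⟨fun hh => ?_, h.nodup_arc (by omega), h.nodup_arc (by omega), ?_⟩
      · rcases List.mem_append.1 hh with hh | hh <;> obtain ⟨i, h1, h2, h3⟩ := mem_arc.1 hh <;>
          exact hw le_rfl (by omega) (by omega) h3
      · intro a ha b hb
        obtain ⟨i, h1, h2, rfl⟩ := mem_arc.1 ha
        obtain ⟨j, h3, h4, rfl⟩ := mem_arc.1 hb
        exact hw (by omega) (by omega) (by omega)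
    · rw [List.isChain_cons, List.isChain_append]
      refine ⟨?_, h.isChain_arc _ _, h.isChain_arc _ _, ?_⟩
      · rw [List.head?_append, head?_arc (by omega)]
        simpa using h02
      · rw [head?_arc (by omega), getLast?_arc (by omega)]
        simp
        convert hdd using 2
        omega
    · rw [List.getLast?_cons, List.getLast?_append, getLast?_arc (a := _ + 2) (by omega)]
      simp
      have := h.adj (n - 1)
      rw [sub_add_cancel, hc0] at this
      convert this using 2
      omega
    · intro v hv
      rcases List.mem_cons.1 hv with rfl | hv
      · exact h.mem 0
      · rcases List.mem_append.1 hv with hv | hv <;> exact h.arc_subset hv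
  by_cases hd3 : 3 ≤ d
  · refine h.not_adj h7 (i := 0) (j := 3) (by omega) (by omega) (key _ ?_ ?_)
    · exact List.mem_cons_of_mem _ (List.mem_append_left _ (mem_arc.2 ⟨3, by omega, by omega, rfl⟩))
    · exact (hw le_rfl (by omega) (by omega)).symm
  · refine h.not_adj h7 (i := 0) (j := 4) (by omega) (by omega) (key _ ?_ ?_)
    · exact List.mem_cons_of_mem _ (List.mem_append_right _ (mem_arc.2 ⟨4, by omega, by omega, rfl⟩))
    · exact (hw le_rfl (by omega) (by omega)).symm

/-- Two chords of length two cross or coincide. -/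
theorem chord (h : Ring G U B n c) (h7 : 7 ≤ n) {i j : ℤ} (h2 : i + 2 ≤ j) (hd : j + 2 ≤ i + n)
    (hi : G.Adj (c i) (c (i + 2))) (hj : G.Adj (c j) (c (j + 2))) : False := by
  by_cases hd3 : j + 3 ≤ i + n
  · refine (h.shift i).chord_aux h7 (d := j - i) (by omega) (by omega) (by simpa using hi) ?_
    convert hj using 2 <;> omega
  · refine (h.shift j).chord_aux h7 (d := 2) (by omega) (by omega) (by simpa using hj) ?_
    have e : j + 2 = i + n := by omega
    have e' : j + (2 + 2) = i + 2 + n := by omega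
    simp only [e, e', h.per]
    exact hi

theorem no_hub (h : Ring G U B n c) (hB : 7 ≤ n ∨ ∀ i, c i ∈ B) {r : V} (hr : r ∈ U)
    (hrc : r ∉ range c) {t : ℤ} (ht : 3 ≤ t) (htn : t + 2 ≤ n)
    (hadj : ∀ i, 0 ≤ i → i ≤ t → G.Adj (c i) r)
    (hcl : ∀ i j, 0 ≤ i → i < j → j ≤ t → G.Adj (c i) (c j)) : False := by
  by_cases h7 : 7 ≤ n
  · exact h.not_adj h7 (i := 0) (j := 3) (by omega) (by omega) (hcl 0 3 le_rfl (by omega) ht)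
  replace hB := hB.resolve_left h7
  have h5 := h.five
  have hodd := h.odd
  obtain rfl : n = 5 := by omega
  obtain rfl : t = 3 := by omega
  have hw : ∀ {i j : ℤ}, 0 ≤ i → i < j → j < 5 → c i ≠ c j := fun h1 h2 h3 =>
    h.ne_of_window h2 (by push_cast; omega)
  have e40 : G.Adj (c 4) (c 0) := by
    have h1 := h.adj 4
    have h2 := h.per 0
    norm_num at h1 h2
    rwa [h2] at h1
  have e34 : G.Adj (c 3) (c 4) := by simpa using h.adj 3
  have hcr : ∀ i, c i ≠ r := fun i hi => hrc ⟨i, hi⟩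
  have hrc' : ∀ i, r ≠ c i := fun i => (hcr i).symm
  have key : ∀ i j : ℤ, (i = 1 ∧ j = 2 ∨ i = 2 ∧ j = 1) → G.Adj (c 4) (c i) := by
    intro i j hij
    have n1 := hw (i := 0) (j := 4) (by omega) (by omega) (by omega)
    have n2 := hw (i := i) (j := 4) (by omega) (by omega) (by omega)
    have n3 := hw (i := 3) (j := 4) (by omega) (by omega) (by omega)
    have n4 := hw (i := 0) (j := i) (by omega) (by omega) (by omega)
    have n5 := hw (i := 0) (j := 3) (by omega) (by omega) (by omega)
    have n6 := hw (i := i) (j := 3) (by omega) (by omega) (by omega)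
    have m1 := hw (i := j) (j := 4) (by omega) (by omega) (by omega)
    have m2 := hw (i := 0) (j := j) (by omega) (by omega) (by omega)
    have m3 := hw (i := j) (j := 3) (by omega) (by omega) (by omega)
    have m4 : c i ≠ c j := by
      rcases hij with ⟨rfl, rfl⟩ | ⟨rfl, rfl⟩
      · exact hw (by omega) (by omega) (by omega)
      · exact (hw (by omega) (by omega) (by omega)).symm
    refine h.miss [c 4, c 0, c i, r, c 3] ⟨⟨?_, ?_, ?_, by simp⟩, by simp; decide, by simp⟩ ?_
      ⟨c j, hB j, ?_⟩ (by simp) (by simp) n2.symm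
    · simp [n1.symm, n2.symm, n3.symm, n4, n5, n6, hcr, hrc']
    · simp [e40, hcl 0 i le_rfl (by omega) (by omega), hadj i (by omega) (by omega),
        (hadj 3 (by omega) (by omega)).symm]
    · simpa using e34
    · simp [h.mem, hr]
    · simp [m1, m2.symm, m3, m4.symm, hcr]
  refine h.not_clique (h.isClique_of fun i j h0 hij hj => ?_)
  by_cases h4 : j ≤ 3
  · exact hcl i j h0 hij h4
  · obtain rfl : j = 4 := by push_cast at hj; omega
    obtain rfl | rfl | rfl | rfl : i = 0 ∨ i = 1 ∨ i = 2 ∨ i = 3 := by omega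
    · exact e40.symm
    · exact (key 1 2 (by simp)).symm
    · exact (key 2 1 (by simp)).symm
    · exact e34

theorem isClique_of_path (h : Ring G U B n c) {t : ℕ} (ht : 0 < t) {R : List V}
    (hR : IsPathList G (U \ range c) {v | G.Adj (c 0) v} {v | G.Adj (c t) v} R)
    (hodd : (R.length + t) % 2 = 0) (h5 : 4 ≤ R.length + t) {j : ℤ} (hj : t < j) (hjn : j < n)
    (hjB : c j ∈ B) : G.IsClique {v | v ∈ R ++ (arc c 0 (t + 1)).reverse} := by
  refine h.miss _ ⟨hR.isCycleList (List.nodup_reverse.2 (h.nodup_arc (by omega))) ?_ ?_ ?_ ?_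
    (by simp; omega), ?_, by simp; omega⟩ ?_ ⟨c j, hjB, ?_⟩
  · rw [List.isChain_reverse]
    exact (h.isChain_arc _ _).imp fun _ _ h => h.symm
  · rw [List.head?_reverse, getLast?_arc (by omega)]
    simp
  · rw [List.getLast?_reverse, head?_arc (by omega)]
  · intro v hv hvU
    obtain ⟨i, -, -, rfl⟩ := mem_arc.1 (List.mem_reverse.1 hv)
    exact hvU.2 ⟨i, rfl⟩
  · rw [Nat.odd_iff]; simp; omega
  · intro v hv
    rcases List.mem_append.1 hv with hv | hv
    · exact (hR.mem v hv).1
    · exact h.arc_subset (List.mem_reverse.1 hv)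
  · intro hv
    rcases List.mem_append.1 hv with hv | hv
    · exact (hR.mem _ hv).2 ⟨j, rfl⟩
    · obtain ⟨i, h1, h2, h3⟩ := mem_arc.1 (List.mem_reverse.1 hv)
      exact h.ne_of_window (i := i) (j := j) (by push_cast at h2; omega) (by omega) h3.symm

theorem no_path_aux (h : Ring G U B n c) (hB : 7 ≤ n ∨ ∀ i, c i ∈ B) {t : ℕ} {R : List V}
    (hR : IsPathList G (U \ range c) {v | G.Adj (c 0) v} {v | G.Adj (c t) v} R)
    (hodd : (R.length + t) % 2 = 0) {i j : ℤ} (hi : 0 < i) (hit : i < t) (hj : t < j) (hjn : j < n)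
    (hiB : c i ∈ B) (hjB : c j ∈ B) : False := by
  have hlen := List.length_pos_of_ne_nil hR.ne_nil
  have hcl := h.isClique_of_path (by omega) hR hodd (by omega) hj hjn hjB
  obtain ⟨r, R', rfl⟩ := List.exists_cons_of_ne_nil hR.ne_nil
  have hr := hR.mem r (by simp)
  have hmem : ∀ i : ℤ, 0 ≤ i → i ≤ t → c i ∈ r :: R' ++ (arc c 0 (t + 1)).reverse :=
    fun i h1 h2 => List.mem_append_right _ (List.mem_reverse.2 (mem_arc.2
      ⟨i, h1, by push_cast; omega, rfl⟩))
  have hadj : ∀ i : ℤ, 0 ≤ i → i ≤ t → G.Adj (c i) r := fun i h1 h2 =>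
    hcl (hmem i h1 h2) (by simp) (fun hh => hr.2 ⟨i, hh⟩)
  by_cases h3 : 3 ≤ t
  · refine h.no_hub hB hr.1 hr.2 (t := t) (by omega) (by omega) hadj fun i j h1 h2 h3 => ?_
    exact hcl (hmem i h1 (by omega)) (hmem j (by omega) h3) (h.ne_of_window h2 (by omega))
  · obtain rfl : t = 2 := by omega
    obtain rfl : i = 1 := by push_cast at hit; omega
    have hn5 := h.five
    have hnodd := h.odd
    have hr' := h.reflect
    have e1 : -((n - 2 : ℕ) : ℤ) = 2 - n := by omega
    have e2 : c (2 - n) = c 2 := by rw [← h.per]; simp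
    have e3 : c (-((n : ℤ) - 1)) = c 1 := by rw [← h.per]; congr 1; ring
    have hR' : IsPathList G (U \ range fun i => c (-i)) {v | G.Adj (c (-0)) v}
        {v | G.Adj (c (-((n - 2 : ℕ) : ℤ))) v} [r] := by
      have hrange : r ∉ range fun i => c (-i) := by
        rintro ⟨i, hi⟩; exact hr.2 ⟨_, hi⟩
      refine ⟨by simp, by simp, by simp, by simpa using ⟨hr.1, by simpa using hrange⟩, ?_, ?_⟩
      · simpa using hadj 0 le_rfl (by omega)
      · simpa [e1, e2] using hadj 2 (by omega) (by omega)
    have hcl' := hr'.isClique_of_path (t := n - 2) (by omega) hR' (by simp; omega) (by simp; omega)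
      (j := n - 1) (by omega) (by omega) (by rwa [e3])
    have hmem' : ∀ i : ℤ, 0 ≤ i → i ≤ (n - 2 : ℕ) → c (-i) ∈
        [r] ++ (arc (fun i => c (-i)) 0 (n - 2 + 1)).reverse :=
      fun i h1 h2 => List.mem_append_right _ (List.mem_reverse.2 (mem_arc.2
        ⟨i, h1, by push_cast; omega, rfl⟩))
    refine hr'.no_hub (r := r) (hB.imp id fun h i => h _) hr.1
      (by rintro ⟨i, hi⟩; exact hr.2 ⟨_, hi⟩) (t := (n - 2 : ℕ)) (by omega) (by omega) ?_ ?_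
    · exact fun i h1 h2 => hcl' (hmem' i h1 h2) (by simp) (fun hh => hr.2 ⟨-i, hh⟩)
    · exact fun i j h1 h2 h3 => hcl' (hmem' i h1 (by omega)) (hmem' j (by omega) h3)
        (hr'.ne_of_window h2 (by omega))

/-- No path outside the ring joins two ring vertices that separate two ring vertices of `B`. -/
theorem no_path (h : Ring G U B n c) (hB : 7 ≤ n ∨ ∀ i, c i ∈ B) {a b : ℤ} {R : List V}
    (hR : IsPathList G (U \ range c) {v | G.Adj (c a) v} {v | G.Adj (c b) v} R)
    {i j : ℤ} (hi : a < i) (hib : i < b) (hj : b < j) (hjn : j < a + n)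
    (hiB : c i ∈ B) (hjB : c j ∈ B) : False := by
  obtain ⟨t, ht⟩ : ∃ t : ℕ, b = a + t := ⟨(b - a).toNat, by omega⟩
  subst ht
  have hnodd := h.odd
  have hs := h.shift a
  have hB' : 7 ≤ n ∨ ∀ i, c (a + i) ∈ B := hB.imp id fun h i => h _
  have hran : range (fun i => c (a + i)) ⊆ range c := by rintro _ ⟨i, rfl⟩; exact ⟨_, rfl⟩
  have hR0 : IsPathList G (U \ range fun i => c (a + i)) {v | G.Adj (c (a + 0)) v}
      {v | G.Adj (c (a + t)) v} R :=
    hR.mono (sdiff_subset_sdiff_right hran) (by simp) Subset.rfl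
  rcases Nat.mod_two_eq_zero_or_one (R.length + t) with hp | hp
  · exact hs.no_path_aux hB' hR0 hp (i := i - a) (j := j - a) (by omega) (by omega) (by omega)
      (by omega) (by simpa using hiB) (by simpa using hjB)
  · have hran' : (range fun i => c (a + -i)) ⊆ range c := by
      rintro _ ⟨i, rfl⟩; exact ⟨_, rfl⟩
    have e : ∀ i, c (a + -(a + n - i)) = c i := fun i => by rw [← h.per]; congr 1; ring
    have e' : a + -((n - t : ℕ) : ℤ) = a + -(a + n - (a + t)) := by omega
    refine hs.reflect.no_path_aux (hB.imp id fun h i => h _) (t := n - t) (R := R) ?_ (by omega)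
      (i := a + n - j) (j := a + n - i) (by omega) (by omega) (by omega) (by omega) ?_ ?_
    · refine hR.mono (sdiff_subset_sdiff_right hran') (by simp) ?_
      rw [e', e]
    · rwa [e]
    · rwa [e]

end Ring

/-- A shortest odd cycle in `U` that is not a clique can be indexed by the integers. -/
theorem exists_ring {G : SimpleGraph V} {U B : Set V} {l : List V} (hl : IsOddCycleList G l)
    (hU : ∀ v ∈ l, v ∈ U) (hcl : ¬ G.IsClique {v | v ∈ l})
    (hshort : ∀ l', IsOddCycleList G l' → (∀ v ∈ l', v ∈ U) → l'.length < l.length →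
      G.IsClique {v | v ∈ l'})
    (hmiss : ∀ l', IsOddCycleList G l' → (∀ v ∈ l', v ∈ U) → (∃ b ∈ B, b ∉ l') →
      G.IsClique {v | v ∈ l'}) :
    ∃ c, Ring G U B l.length c ∧ range c = {v | v ∈ l} := by
  have h5 := hl.five
  have hn0 : (0 : ℤ) < l.length := by omega
  have hnn : ∀ i : ℤ, 0 ≤ i % l.length := fun i => Int.emod_nonneg i hn0.ne'
  have hlt : ∀ i : ℤ, (i % l.length).toNat < l.length := fun i => by
    have := Int.emod_lt_of_pos i hn0
    have := hnn i
    omega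
  let c : ℤ → V := fun i => l[(i % l.length).toNat]'(hlt i)
  have hc : ∀ (i : ℕ) (hi : i < l.length), c i = l[i] := by
    intro i hi
    have : ((i : ℤ) % l.length).toNat = i := by
      rw [Int.emod_eq_of_lt (by omega) (by omega)]; simp
    simp only [c, this]
  have hper : ∀ i, c (i + l.length) = c i := fun i => by simp [c]
  have hcmod : ∀ i, c i = c ((i % l.length).toNat : ℕ) := fun i => by rw [hc _ (hlt i)]
  have hran : range c = {v | v ∈ l} := by
    ext v
    constructor
    · rintro ⟨i, rfl⟩; exact List.getElem_mem _
    · intro hv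
      obtain ⟨i, hi, rfl⟩ := List.mem_iff_getElem.1 hv
      exact ⟨i, hc i hi⟩
  refine ⟨c, ⟨hper, fun i j hij => ?_, fun i => ?_, fun i => hU _ (List.getElem_mem _),
    Nat.odd_iff.1 hl.odd, h5, by rwa [hran], hshort, hmiss⟩, hran⟩
  · have := (List.Nodup.getElem_inj_iff hl.nodup).1 hij
    have h2 : i % l.length = j % l.length := by
      have := hnn i
      have := hnn j
      omega
    exact Int.ModEq.dvd h2
  · set a := (i % l.length).toNat with ha
    have hai : i = a + l.length * (i / l.length) := by
      have := Int.emod_add_mul_ediv i l.length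
      have := hnn i
      omega
    have e1 : c (i + 1) = c ((a + 1 : ℕ) : ℤ) := by
      simp only [c]
      congr 2
      rw [hai]
      push_cast
      rw [show (a : ℤ) + l.length * (i / l.length) + 1 = a + 1 + l.length * (i / l.length) by ring,
        Int.add_mul_emod_self_left]
    rw [e1, hcmod i, ← ha, hc a (hlt i)]
    by_cases h : a + 1 < l.length
    · rw [hc _ h]
      exact List.isChain_iff_getElem.1 hl.chain a h
    · have h' : a + 1 = l.length := by have := hlt i; omega
      have e2 : c ((a + 1 : ℕ) : ℤ) = l[0] := by
        rw [h', ← hc 0 (by omega)]; simpa using hper 0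
      rw [e2]
      refine hl.closes _ ?_ _ ?_
      · rw [List.head?_eq_getElem?]; simp
      · rw [List.getLast?_eq_getElem?]
        simp [← h']

theorem Conn.insert {G : SimpleGraph V} {D : Set V} (hD : Conn G D) {b : V} (hb : b ∈ nbhd G D) :
    Conn G (insert b D) := by
  intro R hR hne hcl
  obtain ⟨hbD, d, hd, hdb⟩ := hb
  have hbR : R = {b} ∨ (R ∩ D).Nonempty := by
    by_contra! h
    refine h.1 (hne.subset_singleton_iff.1 fun v hv => ?_)
    refine (hR hv).resolve_right fun hvD => ?_
    have : v ∈ R ∩ D := ⟨hv, hvD⟩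
    rw [h.2] at this
    exact this
  rcases hbR with rfl | hRD
  · exact absurd hdb.symm (hcl b rfl d ⟨Or.inr hd, hdb.ne⟩)
  · have h1 : R ∩ D = D := hD _ inter_subset_right hRD fun u hu v hv =>
      hcl u hu.1 v ⟨Or.inr hv.1, fun h => hv.2 ⟨h, hv.1⟩⟩
    have h2 : D ⊆ R := inter_eq_right.1 h1
    have hbR : b ∈ R := by
      by_contra h
      exact hcl d (h2 hd) b ⟨Or.inl rfl, h⟩ hdb
    exact hR.antisymm (insert_subset hbR h2)

section

variable [Finite V] {G : SimpleGraph V} {k : ℕ}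

/-- Some non-clique odd cycle does not pass through all vertices. -/
theorem Critical.exists_oddCycle_notMem (hG : Critical G k)
    (hnc : ∃ u v, u ≠ v ∧ ¬ G.Adj u v) :
    ∃ l, IsOddCycleList G l ∧ ¬ G.IsClique {v | v ∈ l} ∧ ∃ w, w ∉ l := by
  classical
  have hk := hG.six
  obtain ⟨l, ⟨hl, hcl⟩, hmin⟩ := WellFounded.has_min (measure (List.length (α := V))).wf
    {l | IsOddCycleList G l ∧ ¬ G.IsClique {v | v ∈ l}} (hG.exists_oddCycle_not_isClique hnc)
  by_contra! hcon
  have hcov := hcon l hl hcl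
  obtain ⟨c, hc, hran⟩ := exists_ring (U := univ) (B := ∅) hl (by simp) hcl
    (fun l' h1 _ h2 => by_contra fun h3 => hmin l' ⟨h1, h3⟩ h2) (by simp)
  have hsurj : ∀ v, ∃ i : ℤ, 0 ≤ i ∧ i < l.length ∧ c i = v := by
    intro v
    have : v ∈ range c := by rw [hran]; exact hcov v
    obtain ⟨i, rfl⟩ := this
    simpa using hc.exists_window 0 i
  choose pos h0 hn hpos using hsurj
  generalize l.length = n at *
  have h5 := hc.five
  have hodd := hc.odd
  have hne : ∀ u v, G.Adj u v → pos u ≠ pos v := fun u v ha h => ha.ne (by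
    rw [← hpos u, ← hpos v, h])
  by_cases h7 : 7 ≤ n
  · have hdiff : ∀ u v, G.Adj u v → pos u < pos v →
        pos v < pos u + 3 ∨ pos u + n < pos v + 3 := by
      intro u v ha hlt
      by_contra! h
      refine hc.not_adj h7 h.1 h.2 ?_
      rwa [hpos, hpos]
    let f : ℤ → ℕ := fun i => if i + 3 ≤ n then (i % 3).toNat else if i + 2 = n then 3 else 4
    have hf : ∀ u v, G.Adj u v → pos u < pos v → f (pos u) ≠ f (pos v) := by
      intro u v ha hlt
      have h1 := hdiff u v ha hlt
      have := h0 u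
      have := h0 v
      have := hn u
      have := hn v
      simp only [f]
      split_ifs <;> omega
    refine hG.not_colorable ⟨fun v => f (pos v), fun v _ => ?_, fun u _ v _ ha => ?_⟩
    · simp only [f, Finset.mem_range]
      split_ifs <;> omega
    · rcases (hne u v ha).lt_or_gt with h | h
      · exact hf u v ha h
      · exact (hf v u ha.symm h).symm
  · refine hG.not_colorable ⟨fun v => (pos v).toNat, fun v _ => ?_, fun u _ v _ ha => ?_⟩
    · have := hn v
      simp only [Finset.mem_range]
      omega
    · have := hne u v ha
      have := h0 u
      have := h0 v
      simp only
      omega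

theorem Critical.exists_extremal (hG : Critical G k) (hnc : ∃ u v, u ≠ v ∧ ¬ G.Adj u v) :
    ∃ D n c, D.Nonempty ∧ Conn G D ∧ Ring G Dᶜ (nbhd G D) n c ∧ nbhd G D ⊆ range c := by
  classical
  obtain ⟨l₀, hl₀, hcl₀, w, hw⟩ := hG.exists_oddCycle_notMem hnc
  obtain ⟨D, ⟨hD, hconn, l₁, hl₁⟩, hmax⟩ := Set.Finite.exists_maximal
    (s := {D : Set V | D.Nonempty ∧ Conn G D ∧ ∃ l, (IsOddCycleList G l ∧ (∀ v ∈ l, v ∈ Dᶜ)) ∧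
      ¬ G.IsClique {v | v ∈ l}}) (Set.toFinite _) ⟨{w}, by simp, fun R hR hne _ =>
        hne.subset_singleton_iff.1 hR, l₀, ⟨hl₀, fun v hv h => hw (h ▸ hv)⟩, hcl₀⟩
  obtain ⟨l, ⟨hl, hcl⟩, hmin⟩ := WellFounded.has_min (measure (List.length (α := V))).wf
    {l | (IsOddCycleList G l ∧ (∀ v ∈ l, v ∈ Dᶜ)) ∧ ¬ G.IsClique {v | v ∈ l}} ⟨l₁, hl₁⟩
  have hB : ∀ l, IsOddCycleList G l → (∀ v ∈ l, v ∈ Dᶜ) → (∃ b ∈ nbhd G D, b ∉ l) →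
      G.IsClique {v | v ∈ l} := by
    rintro l h1 h2 ⟨b, hb, hbl⟩
    by_contra h3
    refine hb.1 (hmax (y := insert b D) ⟨insert_nonempty _ _, hconn.insert hb, l, ⟨h1, ?_⟩, h3⟩
      (subset_insert _ _) (mem_insert _ _))
    rintro v hv (rfl | h)
    · exact hbl hv
    · exact h2 v hv h
  obtain ⟨c, hc, hran⟩ := exists_ring (U := Dᶜ) (B := nbhd G D) hl.1 hl.2 hcl
    (fun l' h1 h2 h3 => by_contra fun h4 => hmin l' ⟨⟨h1, h2⟩, h4⟩ h3) hB
  refine ⟨D, _, c, hD, hconn, hc, fun b hb => ?_⟩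
  rw [hran]
  by_contra h
  exact hcl (hB l hl.1 hl.2 ⟨b, hb, h⟩)

end

/-- Paths through `D` between two almost antipodal vertices of the ring. -/
theorem Critical.not_exists_paths {G : SimpleGraph V} {k : ℕ} (hG : Critical G k)
    {D B : Set V} {n : ℕ} {c : ℤ → V} (hc : Ring G Dᶜ B n c) {g : ℕ} (hg : n = 2 * g + 3) (i : ℤ) :
    ¬ ∃ p, ∀ j < k - 3, ∃ l, IsPathList G D {v | G.Adj (c i) v} {v | G.Adj (c (i + g)) v} l ∧
      l.length = p + j := by
  rintro ⟨p, hp⟩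
  have hk := hG.six
  have h5 := hc.five
  have hD : ∀ a m, ∀ v ∈ arc c a m, v ∉ D := fun a m v hv => hc.arc_subset hv
  refine hG.no_cycles ⟨p + g + 1, fun t ht => ?_⟩
  by_cases h : t < k - 3
  · obtain ⟨l, hl, hn⟩ := hp t h
    have := (hl.isCycleList (m := (arc c i (g + 1)).reverse)
      (List.nodup_reverse.2 (hc.nodup_arc (by omega)))
      (List.isChain_reverse.2 ((hc.isChain_arc _ _).imp fun _ _ h => h.symm))
      (by rw [List.head?_reverse, getLast?_arc (by omega)]; congr 2; push_cast; ring)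
      (by rw [List.getLast?_reverse, head?_arc (by omega)])
      (fun v hv => hD _ _ v (List.mem_reverse.1 hv)) (by simp; omega)).hasCycleLength
    convert this using 1
    simp; omega
  · obtain ⟨l, hl, hn⟩ := hp (t - 3) (by omega)
    have := (hl.isCycleList (m := arc c (i + g) (g + 4))
      (hc.nodup_arc (by omega)) (hc.isChain_arc _ _) (head?_arc (by omega))
      (by rw [getLast?_arc (by omega), ← hc.per i]; congr 2; omega)
      (hD _ _) (by simp)).hasCycleLength
    convert this using 1
    simp; omega

/-- Distance from position zero to the set `B` along the ring. -/
theorem exists_first {G : SimpleGraph V} {U B : Set V} {n : ℕ} {c : ℤ → V} (hc : Ring G U B n c)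
    (hB : ∃ i, c i ∈ B) (h0 : c 0 ∉ B) :
    ∃ p : ℤ, 0 < p ∧ c p ∈ B ∧ ∀ i, 0 ≤ i → i < p → c i ∉ B := by
  classical
  obtain ⟨i, hi⟩ := hB
  obtain ⟨j, h1, -, h2⟩ := hc.exists_window 0 i
  have hex : ∃ m : ℕ, c m ∈ B := ⟨j.toNat, by rwa [Int.toNat_of_nonneg h1, h2]⟩
  refine ⟨Nat.find hex, ?_, Nat.find_spec hex, fun i h1 h2 h3 => ?_⟩
  · rcases Nat.eq_zero_or_pos (Nat.find hex) with h | h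
    · have := Nat.find_spec hex
      rw [h] at this
      exact absurd this h0
    · exact_mod_cast h
  · exact Nat.find_min hex (m := i.toNat) (by omega) (by rwa [Int.toNat_of_nonneg h1])

section

variable [Finite V] {G : SimpleGraph V} {k : ℕ} {D : Set V} {n : ℕ} {c : ℤ → V}

theorem Critical.mem_nbhd_of_five (hG : Critical G k) (hD : D.Nonempty)
    (hc : Ring G Dᶜ (nbhd G D) n c) (hB : nbhd G D ⊆ range c) (h5 : n = 5) :
    c 0 ∈ nbhd G D := by
  subst h5
  by_contra h0
  have hS : nbhd G D ⊆ insert (c 1) (insert (c 2) {c 3, c 4}) := by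
    intro v hv
    obtain ⟨i, rfl⟩ := hB hv
    obtain ⟨j, h1, h2, h3⟩ := hc.exists_window 0 i
    rw [← h3] at hv ⊢
    have h4 : j ≠ 0 := by rintro rfl; exact h0 hv
    have : j = 1 ∨ j = 2 ∨ j = 3 ∨ j = 4 := by omega
    rcases this with rfl | rfl | rfl | rfl <;> simp
  have hcard : ({c 3, c 4} : Set V).ncard = 2 :=
    Set.ncard_pair (hc.ne_of_window (by norm_num) (by norm_num))
  obtain ⟨p, hp⟩ := hG.exists_paths_of_nbhd hD (hc.mem 1) (hc.mem 2) hS (by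
    intro Q hQ hne
    rw [hcard]
    refine hG.four_le_ncard_nbhd hne ⟨c 0, fun h => ?_⟩
    rcases h with h | ⟨-, q, hq, ha⟩
    · exact hc.mem 0 (hQ h)
    · exact h0 ⟨hc.mem 0, q, hQ hq, ha⟩)
  refine hG.not_exists_paths hc (g := 1) rfl 1 ⟨p, fun j hj => ?_⟩
  obtain ⟨l, hl, hn⟩ := hp j (by omega)
  exact ⟨l, by simpa using hl, hn⟩

theorem Critical.mem_nbhd_of_seven (hG : Critical G k) (hD : D.Nonempty)
    (hc : Ring G Dᶜ (nbhd G D) n c) (hB : nbhd G D ⊆ range c) (h7 : 7 ≤ n) :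
    c 0 ∈ nbhd G D := by
  classical
  by_contra h0
  have h4 := hG.four_le_ncard_nbhd hD ⟨c 0, fun h => h.elim (hc.mem 0) h0⟩
  have hex : ∃ i, c i ∈ nbhd G D := by
    by_contra! h
    have : nbhd G D = ∅ := by
      refine eq_empty_of_forall_notMem fun v hv => ?_
      obtain ⟨i, rfl⟩ := hB hv
      exact h i hv
    simp [this] at h4
  obtain ⟨p, hp0, hpB, hp⟩ := exists_first hc hex h0
  obtain ⟨q, hq0, hqB, hq⟩ := exists_first hc.reflect
    (by obtain ⟨i, hi⟩ := hex; exact ⟨-i, by simpa using hi⟩) (by simpa using h0)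
  have hout : ∀ t, -q < t → t < p → c t ∉ nbhd G D := by
    intro t h1 h2
    rcases le_total 0 t with h | h
    · exact hp t h h2
    · simpa using hq (-t) (by omega) (by omega)
  have hsum : p + q + 3 ≤ n := by
    have hsub : nbhd G D ⊆ (arc c p (n + 1 - q - p).toNat).toFinset := by
      intro v hv
      obtain ⟨i, rfl⟩ := hB hv
      obtain ⟨j, h1, h2, h3⟩ := hc.exists_window 0 i
      rw [← h3] at hv ⊢
      have h5 : p ≤ j := by by_contra! h; exact hp j h1 h hv
      have h6 : j ≤ n - q := by
        by_contra! h
        refine hq (n - j) (by omega) (by omega) ?_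
        rwa [← hc.per, show -((n : ℤ) - j) + n = j by ring]
      rw [Finset.mem_coe, List.mem_toFinset, mem_arc]
      exact ⟨j, h5, by omega, rfl⟩
    have h1 := Set.ncard_le_ncard hsub
    rw [Set.ncard_coe_finset] at h1
    have h2 := List.toFinset_card_le (arc c p (n + 1 - q - p).toNat)
    rw [length_arc] at h2
    omega
  set W : Set V := {w | ∃ Y ⊆ Dᶜ \ range c, Conn G Y ∧ (∀ u ∈ Y, ∀ v ∈ (Dᶜ \ range c) \ Y,
    ¬ G.Adj u v) ∧ w ∈ Y ∧ ∃ t, -q < t ∧ t < p ∧ ∃ y ∈ Y, G.Adj (c t) y} with hW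
  set X : Set V := {v | ∃ t, -q < t ∧ t < p ∧ v = c t} ∪ W with hX
  have hXD : ∀ x ∈ X, ∀ w, G.Adj x w → w ∉ D := by
    rintro x (⟨t, h1, h2, rfl⟩ | ⟨Y, hY, -, -, hx, -⟩) w ha hw
    · exact hout t h1 h2 ⟨hc.mem t, w, hw, ha.symm⟩
    · exact (hY hx).2 (hB ⟨(hY hx).1, w, hw, ha.symm⟩)
  have hN : ∀ w ∈ nbhd G X, ∃ j, p ≤ j ∧ j ≤ n - q ∧ w = c j ∧ (j = p ∨ j = n - q ∨
      (j = p + 1 ∧ G.Adj (c (p - 1)) (c (p - 1 + 2))) ∨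
      (j = n - q - 1 ∧ G.Adj (c (n - q - 1)) (c (n - q - 1 + 2)))) := by
    rintro w ⟨hwX, x, hx, ha⟩
    have hwD := hXD x hx w ha
    obtain ⟨i, rfl⟩ : w ∈ range c := by
      by_contra hwC
      refine hwX (Or.inr ?_)
      rcases hx with ⟨t, h1, h2, rfl⟩ | ⟨Y, hY, hconn, hcl, hx, ht⟩
      · obtain ⟨Y, hY, hwY, hconn, hcl⟩ := exists_component G (S := Dᶜ \ range c) ⟨hwD, hwC⟩
        exact ⟨Y, hY, hconn, hcl, hwY, t, h1, h2, w, hwY, ha⟩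
      · refine ⟨Y, hY, hconn, hcl, ?_, ht⟩
        by_contra h
        exact hcl x hx w ⟨⟨hwD, hwC⟩, h⟩ ha
    obtain ⟨j, h1, h2, h3⟩ := hc.exists_window (1 - q) i
    rw [← h3] at ha hwX ⊢
    have h5 : p ≤ j := by
      by_contra! h
      exact hwX (Or.inl ⟨j, by omega, h, rfl⟩)
    refine ⟨j, h5, by omega, rfl, ?_⟩
    by_contra! hj
    obtain ⟨hj1, hj2, hj3, hj4⟩ := hj
    rcases hx with ⟨t, h6, h7', rfl⟩ | ⟨Y, hY, hconn, hcl, hx, t, h6, h7', y, hy, hty⟩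
    · by_cases h8 : j < t + 3
      · refine hj3 (by omega) ?_
        convert ha using 2 <;> omega
      by_cases h9 : t + n < j + 3
      · refine hj4 (by omega) ?_
        rw [show (n : ℤ) - q - 1 + 2 = t + n by omega, hc.per]
        convert ha.symm using 2; omega
      exact hc.not_adj h7 (by omega) (by omega) ha
    · obtain ⟨R, hR⟩ := hconn.exists_path hy (T := {v | G.Adj (c j) v}) ⟨x, ha.symm, hx⟩
      refine hc.no_path (Or.inl h7) (a := t) (b := j) (i := p) (j := n - q)
        (hR.mono hY (by rintro _ rfl; exact hty) subset_rfl) h7' (by omega) (by omega) (by omega) hpB ?_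
      rwa [sub_eq_neg_add, hc.per]
  have h4X := hG.four_le_ncard_nbhd (X := X) ⟨c 0, Or.inl ⟨0, by omega, hp0, rfl⟩⟩ (by
    obtain ⟨d, hd⟩ := hD
    refine ⟨d, fun h => ?_⟩
    rcases h with (⟨t, -, -, rfl⟩ | ⟨Y, hY, -, -, hx, -⟩) | h
    · exact hc.mem t hd
    · exact (hY hx).1 hd
    · obtain ⟨j, -, -, rfl, -⟩ := hN d h
      exact hc.mem j hd)
  obtain ⟨z, hz⟩ : ∃ z, nbhd G X ⊆ {c p, c (n - q), z} := by
    by_cases hch : G.Adj (c (p - 1)) (c (p - 1 + 2))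
    · refine ⟨c (p + 1), fun w hw => ?_⟩
      obtain ⟨j, -, -, rfl, rfl | rfl | ⟨rfl, -⟩ | ⟨-, h⟩⟩ := hN w hw
      · simp
      · simp
      · simp
      · exact (hc.chord h7 (by omega) (by omega) hch h).elim
    · refine ⟨c (n - q - 1), fun w hw => ?_⟩
      obtain ⟨j, -, -, rfl, rfl | rfl | ⟨-, h⟩ | ⟨rfl, -⟩⟩ := hN w hw
      · simp
      · simp
      · exact (hch h).elim
      · simp
  have h6 := (Set.ncard_le_ncard hz).trans (Set.ncard_insert_le _ _)
  have h8 := Set.ncard_insert_le (c (n - q)) {z}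
  rw [Set.ncard_singleton] at h8
  omega

theorem Critical.mem_nbhd (hG : Critical G k) (hD : D.Nonempty)
    (hc : Ring G Dᶜ (nbhd G D) n c) (hB : nbhd G D ⊆ range c) (i : ℤ) : c i ∈ nbhd G D := by
  have hn := hc.five
  have hodd := hc.odd
  have hc' := hc.shift i
  have hB' : nbhd G D ⊆ range fun j => c (i + j) := fun v hv => by
    obtain ⟨j, rfl⟩ := hB hv
    exact ⟨j - i, by simp⟩
  by_cases h : n = 5
  · simpa using hG.mem_nbhd_of_five hD hc' hB' h
  · simpa using hG.mem_nbhd_of_seven hD hc' hB' (by omega)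

theorem Critical.compl_eq_range (hG : Critical G k) (hD : D.Nonempty)
    (hc : Ring G Dᶜ (nbhd G D) n c) (hB : nbhd G D ⊆ range c) : Dᶜ = range c := by
  have hmem := hG.mem_nbhd hD hc hB
  refine Subset.antisymm (fun u hu => ?_) (by rintro _ ⟨i, rfl⟩; exact hc.mem i)
  by_contra huC
  obtain ⟨Y, hY, huY, hconn, hcl⟩ := exists_component G (S := Dᶜ \ range c) ⟨hu, huC⟩
  have hN : nbhd G Y ⊆ range c := by
    rintro w ⟨hwY, y, hy, ha⟩
    by_contra hw
    by_cases hwD : w ∈ D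
    · exact (hY hy).2 (hB ⟨(hY hy).1, w, hwD, ha.symm⟩)
    · exact hcl y hy w ⟨⟨hwD, hw⟩, hwY⟩ ha
  have h4 := hG.four_le_ncard_nbhd ⟨u, huY⟩ (by
    obtain ⟨d, hd⟩ := hD
    refine ⟨d, fun h => h.elim (fun h => (hY h).1 hd) fun h => ?_⟩
    obtain ⟨i, rfl⟩ := hN h
    exact hc.mem i hd)
  obtain ⟨w, hw⟩ := Set.nonempty_of_ncard_ne_zero (s := nbhd G Y) (by omega)
  obtain ⟨a, rfl⟩ := hN hw
  obtain ⟨-, y, hy, hya⟩ := hw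
  obtain ⟨w, hw1, hw2⟩ : ∃ w ∈ nbhd G Y, w ∉ ({c a, c (a + 1), c (a - 1)} : Set V) := by
    refine Set.exists_mem_notMem_of_ncard_lt_ncard ?_
    have h6 := Set.ncard_insert_le (c a) {c (a + 1), c (a - 1)}
    have h8 := Set.ncard_insert_le (c (a + 1)) {c (a - 1)}
    rw [Set.ncard_singleton] at h8
    omega
  obtain ⟨i, rfl⟩ := hN hw1
  obtain ⟨-, y', hy', hyw⟩ := hw1
  obtain ⟨b, h1, h2, h3⟩ := hc.exists_window a i
  rw [← h3] at hyw hw2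
  obtain ⟨R, hR⟩ := hconn.exists_path hy (T := {v | G.Adj (c b) v}) ⟨y', hyw.symm, hy'⟩
  have hb : b ≠ a ∧ b ≠ a + 1 ∧ b ≠ a + n - 1 := by
    refine ⟨?_, ?_, ?_⟩ <;> rintro rfl <;> apply hw2
    · simp
    · simp
    · rw [show a + n - 1 = a - 1 + (n : ℤ) by ring, hc.per]; simp
  exact hc.no_path (Or.inr hmem) (a := a) (b := b) (i := a + 1) (j := b + 1)
    (hR.mono hY (by rintro _ rfl; exact hya.symm) subset_rfl) (by omega) (by omega) (by omega)
    (by omega) (hmem _) (hmem _)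

end

theorem not_subset_of_three {G : SimpleGraph V} {F : Set V} {m : ℕ} (hm : 3 ≤ m)
    (hF : ¬ ∃ f, ColorsOn G F (Finset.range m) f) (a b d : V) : ¬ F ⊆ {a, b, d} := by
  classical
  intro h
  refine hF ⟨fun v => if v = a then 0 else if v = b then 1 else 2, fun v _ => ?_,
    fun u hu v hv ha hne => ?_⟩
  · simp only [Finset.mem_range]
    split_ifs <;> omega
  · have hu := h hu
    have hv := h hv
    have := ha.ne
    simp only [mem_insert_iff, mem_singleton_iff] at hu hv
    grind

/-- `O` is attached to the rest of `D` at `b` only, and contains no other vertex of `F`. -/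
structure Flap (G : SimpleGraph V) (D F O : Set V) (b : V) : Prop where
  mem : b ∈ O
  subset : O ⊆ D
  adj : ∀ u ∈ O, ∀ v ∈ D \ O, G.Adj u v → u = b
  inter : F ∩ O ⊆ {b}

namespace Flap

variable {G : SimpleGraph V} {D F O O' : Set V} {b b' : V}

theorem subset_of_notMem (h : Flap G D F O b) (h' : Flap G D F O' b') (hD : Conn G D)
    (h1 : b' ∈ O) (h2 : b ∉ O') : O' ⊆ O := by
  by_contra hsub
  obtain ⟨w, hw, hwO⟩ := Set.not_subset.1 hsub
  have := hD (O' \ O) (fun v hv => h'.subset hv.1) ⟨w, hw, hwO⟩ fun u hu v hv ha => by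
    by_cases hvO : v ∈ O
    · obtain rfl := h.adj v hvO u ⟨h'.subset hu.1, hu.2⟩ ha.symm
      exact hu.2 (h'.adj u hu.1 v ⟨hv.1, h2⟩ ha ▸ h1)
    · exact hu.2 (h'.adj u hu.1 v ⟨hv.1, fun h => hv.2 ⟨h, hvO⟩⟩ ha ▸ h1)
  exact h2 (this.symm.subset (h.subset h.mem)).1

theorem union {m : ℕ} (hm : 3 ≤ m) (hF : ¬ ∃ f, ColorsOn G F (Finset.range m) f) (hFD : F ⊆ D)
    (h : Flap G D F O b) (h' : Flap G D F O' b') (hD : Conn G D) (hne : (O ∩ O').Nonempty) :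
    ∃ b'', Flap G D F (O ∪ O') b'' := by
  by_cases h1 : b' ∈ O <;> by_cases h2 : b ∈ O'
  · by_cases hbb : b = b'
    · subst hbb
      refine ⟨b, Or.inl h1, union_subset h.subset h'.subset, ?_, ?_⟩
      · rintro u (hu | hu) v hv ha
        · exact h.adj u hu v ⟨hv.1, fun h => hv.2 (Or.inl h)⟩ ha
        · exact h'.adj u hu v ⟨hv.1, fun h => hv.2 (Or.inr h)⟩ ha
      · rintro v ⟨hv, hv' | hv'⟩
        · exact h.inter ⟨hv, hv'⟩
        · exact h'.inter ⟨hv, hv'⟩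
    exfalso
    by_cases hX : (D \ (O ∪ O')).Nonempty
    · have := hD _ sdiff_subset hX fun u hu v hv ha => by
        have hv' : v ∈ O ∪ O' := by_contra fun h => hv.2 ⟨hv.1, h⟩
        have hvb : v ∈ O → v = b := fun h3 => h.adj v h3 u ⟨hu.1, fun h => hu.2 (Or.inl h)⟩ ha.symm
        have hvb' : v ∈ O' → v = b' := fun h3 =>
          h'.adj v h3 u ⟨hu.1, fun h => hu.2 (Or.inr h)⟩ ha.symm
        rcases hv' with h3 | h3
        · exact hbb ((hvb h3).symm.trans (hvb' (hvb h3 ▸ h2)))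
        · exact hbb ((hvb (hvb' h3 ▸ h1)).symm.trans (hvb' h3))
      exact (this.symm.subset (h.subset h.mem)).2 (Or.inl h.mem)
    · refine not_subset_of_three hm hF b b' b' fun v hv => ?_
      have : v ∈ O ∪ O' := by_contra fun h3 => hX ⟨v, hFD hv, h3⟩
      rcases this with h3 | h3
      · exact Or.inl (h.inter ⟨hv, h3⟩)
      · exact Or.inr (Or.inl (h'.inter ⟨hv, h3⟩))
  · rw [union_eq_left.2 (h.subset_of_notMem h' hD h1 h2)]
    exact ⟨b, h⟩
  · rw [union_eq_right.2 (h'.subset_of_notMem h hD h2 h1)]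
    exact ⟨b', h'⟩
  · have := hD (O ∩ O') (fun v hv => h.subset hv.1) hne fun u hu v hv ha => by
      by_cases hvO : v ∈ O
      · exact h1 (h'.adj u hu.2 v ⟨hv.1, fun h => hv.2 ⟨hvO, h⟩⟩ ha ▸ hu.1)
      · exact h2 (h.adj u hu.1 v ⟨hv.1, hvO⟩ ha ▸ hu.2)
    exact (h2 (this.symm.subset (h.subset h.mem)).2).elim

end Flap

/-- Some pair of almost antipodal ring vertices leaves a rest that is coloured by parity. -/
theorem Ring.exists_parity {G : SimpleGraph V} {U B : Set V} {n g : ℕ} {c : ℤ → V}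
    (hc : Ring G U B n c) (hg : n = 2 * g + 3) :
    ∃ s : ℤ, ∀ i j : ℤ, 0 < i → i < j → j < n → i ≠ g → j ≠ g → G.Adj (c (s + i)) (c (s + j)) →
      (j - i) % 2 = 1 := by
  by_cases h7 : 7 ≤ n
  · have key : ∀ s i j : ℤ, 0 < i → i < j → j < n → G.Adj (c (s + i)) (c (s + j)) →
        (j - i) % 2 ≠ 1 → j = i + 2 := by
      intro s i j h1 h2 h3 ha h4
      by_contra h5
      exact hc.not_adj h7 (by omega) (by omega) ha
    by_cases hch : ∃ m, G.Adj (c m) (c (m + 2))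
    · obtain ⟨m, hm⟩ := hch
      refine ⟨m + 1, fun i j h1 h2 h3 _ _ ha => ?_⟩
      by_contra h4
      obtain rfl := key _ i j h1 h2 h3 ha h4
      exact hc.chord h7 (i := m) (j := m + 1 + i) (by omega) (by omega) hm
        (by rwa [add_assoc (m + 1)])
    · refine ⟨0, fun i j h1 h2 h3 _ _ ha => ?_⟩
      by_contra h4
      obtain rfl := key _ i j h1 h2 h3 ha h4
      exact hch ⟨0 + i, by rwa [add_assoc]⟩
  · have h5 := hc.five
    obtain rfl : g = 1 := by omega
    obtain rfl : n = 5 := by omega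
    obtain ⟨a, ha⟩ : ∃ a, ¬ G.Adj (c a) (c (a + 2)) := by
      by_contra! h
      refine hc.not_clique (hc.isClique_of fun i j h1 h2 h3 => ?_)
      have : j = i + 1 ∨ j = i + 2 ∨ i + 5 = j + 2 ∨ i + 5 = j + 1 := by push_cast at h3; omega
      rcases this with rfl | rfl | h5 | h5
      · exact hc.adj i
      · exact h i
      · rw [← hc.per i, Nat.cast_ofNat, h5]; exact (h j).symm
      · rw [← hc.per i, Nat.cast_ofNat, h5]; exact (hc.adj j).symm
    refine ⟨a - 2, fun i j h1 h2 h3 h4 h5 hadj => ?_⟩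
    by_contra h6
    obtain ⟨rfl, rfl⟩ : i = 2 ∧ j = 4 := by push_cast at *; omega
    refine ha ?_
    convert hadj using 2 <;> ring

section

variable [Finite V] {G : SimpleGraph V} {k : ℕ} {D : Set V} {n g : ℕ} {c : ℤ → V}

/-- A set without two exits, as provided by the absence of paths of many lengths. -/
theorem Critical.exists_single_exit (hG : Critical G k) (hD : Conn G D)
    (hc : Ring G Dᶜ (nbhd G D) n c) (hB : ∀ i, c i ∈ nbhd G D) (hg : n = 2 * g + 3) (i : ℤ)
    {Z₀ : Set V} (hZ₀ : Z₀ ⊆ D) {α β : ℕ} (hcol : ¬ TypedColorable G Z₀ {v | G.Adj (c i) v}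
      {v | G.Adj (c (i + g)) v} (Finset.range (k - 2)) α β) :
    ∃ Q ⊆ D, (Q ∩ Z₀).Nonempty ∧ (∃ b ∈ D \ Q, ∀ u ∈ Q, ∀ v ∈ D \ Q, G.Adj u v → v = b) ∧
      ∀ u ∈ Q, ¬ G.Adj (c i) u ∧ ¬ G.Adj (c (i + g)) u := by
  obtain ⟨Q, hQ, hQZ, e, he⟩ : ∃ Q ⊆ D, (Q ∩ Z₀).Nonempty ∧ ∃ e, ∀ e',
      Exit G D {v | G.Adj (c i) v} {v | G.Adj (c (i + g)) v} Q e' → e' = e := by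
    by_contra! hcon
    obtain ⟨Z, hZZ, hZD, hlink⟩ := exists_twoLinked hZ₀ fun Q hQ hne e => by
      obtain ⟨e', h1, h2⟩ := hcon Q hQ hne e
      exact ⟨e', h2, h1⟩
    obtain ⟨p, hp⟩ := hlink.exists_paths_of_colors (C := Finset.range (k - 2)) (α := α) (β := β)
      fun ⟨f, hf, h1, h2⟩ => hcol ⟨f, ⟨fun v hv => hf.1 v (hZZ hv), fun u hu v hv =>
        hf.2 u (hZZ hu) v (hZZ hv)⟩, fun v hv => h1 v (hZZ hv), fun v hv => h2 v (hZZ hv)⟩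
    refine hG.not_exists_paths hc hg i ⟨p, fun j hj => ?_⟩
    obtain ⟨l, hl, hn⟩ := hp j (by simp; omega)
    exact ⟨l, hl.mono hZD subset_rfl subset_rfl, hn⟩
  have hQD : Q ≠ D := by
    rintro rfl
    obtain ⟨-, x, hx, hx'⟩ := hB i
    obtain ⟨-, y, hy, hy'⟩ := hB (i + g)
    have h1 := he (.inr true) ⟨x, hx, hx'.symm⟩
    have h2 := he (.inr false) ⟨y, hy, hy'.symm⟩
    simp [← h2] at h1
  obtain ⟨u, hu, b, hb, hub⟩ : ∃ u ∈ Q, ∃ v ∈ D \ Q, G.Adj u v := by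
    by_contra! h
    exact hQD (hD Q hQ (hQZ.mono inter_subset_left) h)
  have heb := he (.inl b) ⟨hb.1, hb.2, u, hu, hub⟩
  subst heb
  refine ⟨Q, hQ, hQZ, ⟨b, hb, fun u hu v hv ha => ?_⟩, fun u hu => ⟨fun h => ?_, fun h => ?_⟩⟩
  · simpa using he (.inl v) ⟨hv.1, hv.2, u, hu, ha⟩
  · simpa using he (.inr true) ⟨u, hu, h⟩
  · simpa using he (.inr false) ⟨u, hu, h⟩

theorem Critical.not_colorable_compl (hG : Critical G k) (hD : Conn G D)
    (hc : Ring G Dᶜ (nbhd G D) n c) (hB : ∀ i, c i ∈ nbhd G D) (hU : Dᶜ = range c)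
    (hg : n = 2 * g + 3) : ¬ ∃ f, ColorsOn G D (Finset.range (k - 2)) f := by
  classical
  rintro ⟨φ, hφ⟩
  have hk := hG.six
  obtain ⟨s, hs⟩ := hc.exists_parity hg
  replace hc := hc.shift s
  replace hB : ∀ i, c (s + i) ∈ nbhd G D := fun i => hB _
  replace hU : Dᶜ = range fun i => c (s + i) := by
    rw [hU]
    ext v
    exact ⟨fun ⟨i, h⟩ => ⟨i - s, by simpa using h⟩, fun ⟨i, h⟩ => ⟨_, h⟩⟩
  generalize hc' : (fun i => c (s + i)) = d at *
  have hcd : ∀ i, c (s + i) = d i := fun i => by rw [← hc']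
  simp only [hcd] at hs hB
  clear hc' hcd
  have hbase : ¬ TypedColorable G D {v | G.Adj (d 0) v} {v | G.Adj (d (0 + g)) v}
      (Finset.range (k - 2)) 0 1 := by
    rintro ⟨f, hf, h0, h1⟩
    have hpos : ∀ v ∈ Dᶜ, ∃ i : ℤ, 0 ≤ i ∧ i < n ∧ d i = v := by
      intro v hv
      rw [hU] at hv
      obtain ⟨i, rfl⟩ := hv
      simpa using hc.exists_window 0 i
    choose! pos hp0 hpn hpd using hpos
    let h : V → ℕ := fun v => if pos v = 0 then 0 else if pos v = g then 1 else
      k - 2 + (pos v % 2).toNat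
    refine hG.not_colorable ⟨_, ColorsOn.glue (Q := D) (f := h) (g := f) ?_ ?_ ?_⟩
    · rw [← compl_eq_univ_sdiff]
      have key : ∀ u ∈ Dᶜ, ∀ v ∈ Dᶜ, pos u < pos v → G.Adj u v → h u ≠ h v := by
        intro u hu v hv hlt ha
        have h1 := hp0 u hu
        have h2 := hpn v hv
        have h3 := hs (pos u) (pos v)
        rw [hpd u hu, hpd v hv] at h3
        simp only [h]
        split_ifs <;> grind
      refine ⟨fun v hv => ?_, fun u hu v hv ha => ?_⟩
      · simp only [h, Finset.mem_range]
        split_ifs <;> omega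
      · rcases lt_trichotomy (pos u) (pos v) with hl | he | hl
        · exact key u hu v hv hl ha
        · exact (ha.ne (by rw [← hpd u hu, ← hpd v hv, he])).elim
        · exact (key v hv u hu hl ha.symm).symm
    · rw [univ_inter]
      exact ⟨fun v hv => Finset.mem_range.2 (by have := Finset.mem_range.1 (hf.1 v hv); omega), hf.2⟩
    · rintro u ⟨-, hu⟩ v ⟨-, hv⟩ ha
      have h2 := Finset.mem_range.1 (hf.1 u hu)
      have h3 := hpd v hv
      simp only [h]
      split_ifs with h4 h5
      · refine h0 u hu ?_
        rw [← h4, h3]; exact ha.symm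
      · refine h1 u hu ?_
        rw [zero_add, ← h5, h3]; exact ha.symm
      · omega
  obtain ⟨Z, hZ⟩ := Set.Finite.exists_minimal (s := {Z : Set V | Z ⊆ D ∧ ¬ TypedColorable G Z
    {v | G.Adj (d 0) v} {v | G.Adj (d (0 + g)) v} (Finset.range (k - 2)) 0 1})
    (Set.toFinite _) ⟨D, subset_rfl, hbase⟩
  obtain ⟨Q, hQ, ⟨z, hzQ, hzZ⟩, ⟨b, hb, hQb⟩, hQ'⟩ :=
    hG.exists_single_exit hD hc hB hg 0 hZ.1.1 hZ.1.2
  obtain ⟨f, hf, hfx, hfy⟩ : TypedColorable G (Z \ Q) {v | G.Adj (d 0) v}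
      {v | G.Adj (d (0 + g)) v} (Finset.range (k - 2)) 0 1 := by
    by_contra h
    exact (hZ.2 ⟨sdiff_subset.trans hZ.1.1, h⟩ sdiff_subset hzZ).2 hzQ
  obtain ⟨a, ha, hab⟩ : ∃ a ∈ Finset.range (k - 2), b ∈ Z → f b = a := by
    by_cases hbZ : b ∈ Z
    · exact ⟨f b, hf.1 b ⟨hbZ, hb.2⟩, fun _ => rfl⟩
    · exact ⟨φ b, hφ.1 b hb.1, fun h => (hbZ h).elim⟩
  obtain ⟨σ, hσ, hσ', hσb, -⟩ := exists_recolor (P := Finset.range (k - 2))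
    (P' := Finset.range (k - 2)) le_rfl (hφ.1 b hb.1) (hφ.1 b hb.1) ha ha (by simp)
  have hφ' := hφ.comp hσ hσ'
  refine hZ.1.2 ⟨_, ColorsOn.glue (Q := Q) hf (g := σ ∘ φ) ?_ ?_, ?_, ?_⟩
  · exact ⟨fun v hv => hφ'.1 v (hQ hv.2), fun u hu v hv => hφ'.2 u (hQ hu.2) v (hQ hv.2)⟩
  · rintro u ⟨-, hu⟩ v ⟨hvZ, hv⟩ huv
    obtain rfl := hQb u hu v ⟨hZ.1.1 hvZ, hv⟩ huv
    rw [hab hvZ, ← hσb]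
    exact hφ'.2 u (hQ hu) v hb.1 huv
  · intro v hv hvA
    have hvQ : v ∉ Q := fun h => (hQ' v h).1 hvA
    simpa [hvQ] using hfx v ⟨hv, hvQ⟩ hvA
  · intro v hv hvA
    have hvQ : v ∉ Q := fun h => (hQ' v h).2 hvA
    simpa [hvQ] using hfy v ⟨hv, hvQ⟩ hvA

theorem Critical.exists_flap (hG : Critical G k) (hD : Conn G D)
    (hc : Ring G Dᶜ (nbhd G D) n c) (hB : ∀ i, c i ∈ nbhd G D) (hg : n = 2 * g + 3)
    {F : Set V} (hFD : F ⊆ D)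
    (hF : Minimal (fun F => ¬ ∃ f, ColorsOn G F (Finset.range (k - 2)) f) F) (i : ℤ) :
    ∃ O b, Flap G D F O b ∧ (∀ v ∈ D, G.Adj (c i) v → v ∈ O) ∧
      ∀ v ∈ D, G.Adj (c (i + g)) v → v ∈ O := by
  obtain ⟨Q, hQ, ⟨z, hzQ, hzF⟩, ⟨b, hb, hQb⟩, hQ'⟩ :=
    hG.exists_single_exit hD hc hB hg i hFD (α := 0) (β := 0) fun ⟨f, hf, _⟩ => hF.1 ⟨f, hf⟩
  refine ⟨D \ Q, b, ⟨hb, sdiff_subset, fun u hu v hv ha => ?_, ?_⟩,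
    fun v hv h => ⟨hv, fun hvQ => (hQ' v hvQ).1 h⟩, fun v hv h => ⟨hv, fun hvQ => (hQ' v hvQ).2 h⟩⟩
  · exact hQb v (by_contra fun h => hv.2 ⟨hv.1, h⟩) u hu ha.symm
  · rintro w ⟨hwF, hwD, hwQ⟩
    by_contra hwb
    rw [mem_singleton_iff] at hwb
    have hcol : ∀ S ⊆ F, S ≠ F → ∃ f, ColorsOn G S (Finset.range (k - 2)) f := fun S hS hne =>
      by_contra fun h => hne (hS.antisymm (hF.2 h hS))
    obtain ⟨f₁, h₁⟩ := hcol (F \ Q) sdiff_subset fun h => (h.symm.subset hzF).2 hzQ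
    obtain ⟨f₂, h₂⟩ := hcol (F ∩ insert b Q) inter_subset_left fun h =>
      (h.symm.subset hwF).2.elim hwb hwQ
    obtain ⟨f, hf, -⟩ := exists_glue_at (s := b) h₁ h₂ (by
      rintro v ⟨hv, hv'⟩
      exact hv'.2.resolve_right hv.2) (by
      rintro u ⟨hu, hu'⟩ v ⟨hv, hv'⟩ ha
      have hvQ : v ∈ Q := by_contra fun h => hv' ⟨hv.1, h⟩
      exact hu' ⟨hu.1, Or.inl (hQb v hvQ u ⟨hFD hu.1, hu.2⟩ ha.symm)⟩)
    refine hF.1 ⟨f, ?_⟩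
    convert hf
    ext v
    simp only [mem_union, mem_sdiff, mem_inter_iff, mem_insert_iff]
    tauto

/-- A critical graph without many consecutive cycle lengths is complete. -/
theorem Critical.adj_of_ne (hG : Critical G k) {u v : V} (huv : u ≠ v) : G.Adj u v := by
  by_contra hadj
  have hk := hG.six
  obtain ⟨D, n, c, hDne, hD, hc, hBC⟩ := hG.exists_extremal ⟨u, v, huv, hadj⟩
  have hB := hG.mem_nbhd hDne hc hBC
  have hU := hG.compl_eq_range hDne hc hBC
  obtain ⟨g, hg⟩ : ∃ g, n = 2 * g + 3 := ⟨(n - 3) / 2, by have := hc.five; have := hc.odd; omega⟩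
  have hDcol := hG.not_colorable_compl hD hc hB hU hg
  obtain ⟨F, hFD, hF⟩ := Set.Finite.exists_le_minimal
    (s := {F : Set V | ¬ ∃ f, ColorsOn G F (Finset.range (k - 2)) f}) (Set.toFinite _) hDcol
  replace hF : Minimal (fun F => ¬ ∃ f, ColorsOn G F (Finset.range (k - 2)) f) F := hF
  have hflap : ∀ i, ∃ O, Maximal (fun O => ∃ b, Flap G D F O b) O ∧
      (∀ v ∈ D, G.Adj (c i) v → v ∈ O) ∧ ∀ v ∈ D, G.Adj (c (i + g)) v → v ∈ O := by
    intro i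
    obtain ⟨O, b, hO, h1, h2⟩ := hG.exists_flap hD hc hB hg hFD hF i
    obtain ⟨M, hOM, hM⟩ := Set.Finite.exists_le_maximal (s := {O | ∃ b, Flap G D F O b})
      (Set.toFinite _) ⟨b, hO⟩
    exact ⟨M, hM, fun v hv ha => hOM (h1 v hv ha), fun v hv ha => hOM (h2 v hv ha)⟩
  choose M hM hM1 hM2 using hflap
  have heq : ∀ i j, (M i ∩ M j).Nonempty → M i = M j := by
    intro i j hne
    obtain ⟨b, hb⟩ := (hM i).1
    obtain ⟨b', hb'⟩ := (hM j).1
    have hu := hb.union (by omega) hF.1 hFD hb' hD hne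
    exact ((hM i).eq_of_subset hu subset_union_left).trans
      ((hM j).eq_of_subset hu subset_union_right).symm
  have hg' : ∀ i, M (i + g) = M i := by
    intro i
    obtain ⟨-, x, hx, hx'⟩ := hB (i + g)
    exact heq _ _ ⟨x, hM1 _ x hx hx'.symm, hM2 _ x hx hx'.symm⟩
  have hn' : ∀ i, M (i + n) = M i := by
    intro i
    obtain ⟨-, x, hx, hx'⟩ := hB i
    exact heq _ _ ⟨x, hM1 _ x hx (by rw [hc.per]; exact hx'.symm), hM1 _ x hx hx'.symm⟩
  have h3 : ∀ i, M (i + 3) = M i := by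
    intro i
    rw [← hn' i, ← hg' (i + 3), ← hg' (i + 3 + g)]
    congr 1
    push_cast [hg]
    ring
  have hmod : ∀ i, M i = M 0 ∨ M i = M 1 ∨ M i = M 2 := by
    intro i
    have hper : Function.Periodic M 3 := h3
    have h4 : M i = M (i % 3) := by
      have := hper.int_mul (i / 3) (i % 3)
      rw [← this]
      congr 1
      have := Int.emod_add_mul_ediv i 3
      simp only [Int.cast_id]
      omega
    have : i % 3 = 0 ∨ i % 3 = 1 ∨ i % 3 = 2 := by omega
    rcases this with h | h | h <;> rw [h] at h4 <;> simp [h4]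
  obtain ⟨a, ha⟩ := (hM 0).1
  obtain ⟨b, hb⟩ := (hM 1).1
  obtain ⟨d, hd⟩ := (hM 2).1
  set X := D \ (M 0 ∪ M 1 ∪ M 2) with hX
  have hXne : X.Nonempty := by
    by_contra! h
    refine not_subset_of_three (by omega) hF.1 a b d fun v hv => ?_
    have h5 : v ∉ X := by simp [h]
    have h6 : v ∈ M 0 ∪ M 1 ∪ M 2 := by_contra fun h => h5 ⟨hFD hv, h⟩
    rcases h6 with (h6 | h6) | h6
    · exact Or.inl (ha.inter ⟨hv, h6⟩)
    · exact Or.inr (Or.inl (hb.inter ⟨hv, h6⟩))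
    · exact Or.inr (Or.inr (hd.inter ⟨hv, h6⟩))
  have hXc : ∀ x ∈ X, ∀ i, ¬ G.Adj (c i) x := by
    intro x hx i hi
    have := hM1 i x hx.1 hi
    rcases hmod i with h | h | h <;> rw [h] at this <;> exact hx.2 (by simp [this])
  have hN : nbhd G X ⊆ {a, b, d} := by
    rintro w ⟨hw, x, hx, hxw⟩
    have hwD : w ∈ D := by
      by_contra h
      obtain ⟨i, rfl⟩ := hU.subset h
      exact hXc x hx i hxw.symm
    have hw' : w ∈ M 0 ∪ M 1 ∪ M 2 := by_contra fun h => hw ⟨hwD, h⟩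
    rcases hw' with (h6 | h6) | h6
    · exact Or.inl (ha.adj w h6 x ⟨hx.1, fun h => hx.2 (Or.inl (Or.inl h))⟩ hxw.symm)
    · exact Or.inr (Or.inl (hb.adj w h6 x ⟨hx.1, fun h => hx.2 (Or.inl (Or.inr h))⟩ hxw.symm))
    · exact Or.inr (Or.inr (hd.adj w h6 x ⟨hx.1, fun h => hx.2 (Or.inr h)⟩ hxw.symm))
  have h4 := hG.four_le_ncard_nbhd hXne ⟨c 0, fun h => h.elim (fun h => hc.mem 0 h.1)
    fun ⟨_, x, hx, ha⟩ => hXc x hx 0 ha.symm⟩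
  have h6 := (Set.ncard_le_ncard hN).trans (Set.ncard_insert_le _ _)
  have h8 := Set.ncard_insert_le b {d}
  rw [Set.ncard_singleton] at h8
  omega

end

theorem hasCycleLength_of_induce {G : SimpleGraph V} {W : Set V} {m : ℕ}
    (h : HasCycleLength (G.induce W) m) : HasCycleLength G m := by
  obtain ⟨u, p, hp, rfl⟩ := h
  exact ⟨_, p.map (SimpleGraph.Embedding.induce W).toHom,
    hp.map Subtype.val_injective, SimpleGraph.Walk.length_map _ _⟩

theorem exists_adj_of_preconnected {G : SimpleGraph V} {S A : Set V}
    (hS : (G.induce S).Preconnected) (hA : (S ∩ A).Nonempty) (hA' : (S \ A).Nonempty) :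
    ∃ a ∈ S ∩ A, ∃ b ∈ S \ A, G.Adj a b := by
  obtain ⟨a, haS, haA⟩ := hA
  obtain ⟨b, hbS, hbA⟩ := hA'
  obtain ⟨p⟩ := hS ⟨a, haS⟩ ⟨b, hbS⟩
  obtain ⟨d, -, h1, h2⟩ := p.exists_boundary_dart (Subtype.val ⁻¹' A) haA hbA
  exact ⟨d.fst, ⟨d.fst.2, h1⟩, d.snd, ⟨d.snd.2, h2⟩, d.adj⟩

theorem preconnected_induce_of_isClique {G : SimpleGraph V} {S : Set V} (hS : G.IsClique S) :
    (G.induce S).Preconnected := by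
  intro u v
  by_cases h : u = v
  · exact h ▸ SimpleGraph.Reachable.refl _
  · exact SimpleGraph.Adj.reachable (hS u.2 v.2 fun h' => h (Subtype.ext h'))

/-- Without many consecutive cycle lengths, a graph that needs more than `k` colours contains a
clique that needs more than `k` colours. -/
theorem exists_isClique_not_colorable [Finite V] {G : SimpleGraph V} {k : ℕ} (hk : 6 ≤ k)
    (hG : ¬ G.Colorable k) (hcyc : ¬ ∃ ℓ, ∀ i < k, HasCycleLength G (ℓ + i)) :
    ∃ W, G.IsClique W ∧ k < W.ncard := by
  classical
  obtain ⟨W, hW⟩ := Set.Finite.exists_minimal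
    (s := {W : Set V | ¬ ∃ f, ColorsOn G W (Finset.range k) f}) (Set.toFinite _) ⟨univ, by
      rintro ⟨f, hf⟩
      exact hG ⟨SimpleGraph.Coloring.mk (fun v => ⟨f v, Finset.mem_range.1 (hf.1 v trivial)⟩)
        fun ha h => hf.2 _ trivial _ trivial ha (by simpa using h)⟩⟩
  have hcrit : Critical (G.induce W) k := by
    refine ⟨hk, ?_, fun S hS => ?_, fun ⟨ℓ, h⟩ => hcyc ⟨ℓ, fun i hi => hasCycleLength_of_induce (h i hi)⟩⟩
    · rintro ⟨f, hf⟩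
      refine hW.1 ⟨fun v => if h : v ∈ W then f ⟨v, h⟩ else 0, fun v hv => ?_,
        fun u hu v hv ha => ?_⟩
      · simpa [hv] using hf.1 ⟨v, hv⟩ trivial
      · simpa [hu, hv] using hf.2 ⟨u, hu⟩ trivial ⟨v, hv⟩ trivial ha
    · obtain ⟨f, hf⟩ : ∃ f, ColorsOn G (Subtype.val '' S) (Finset.range k) f := by
        by_contra h
        refine hS (eq_univ_of_forall fun v => ?_)
        obtain ⟨u, hu, huv⟩ := hW.2 h (by rintro _ ⟨u, -, rfl⟩; exact u.2) v.2
        exact Subtype.ext huv ▸ hu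
      exact ⟨fun v => f v, fun v hv => hf.1 v (mem_image_of_mem _ hv), fun u hu v hv ha =>
        hf.2 u (mem_image_of_mem _ hu) v (mem_image_of_mem _ hv) ha⟩
  refine ⟨W, fun u hu v hv huv => hcrit.adj_of_ne (u := ⟨u, hu⟩) (v := ⟨v, hv⟩)
    fun h => huv (congrArg Subtype.val h), ?_⟩
  by_contra! hcard
  have e := Finite.equivFin W
  rw [Nat.card_coe_set_eq] at e
  refine hcrit.not_colorable ⟨fun v => e v, fun v _ => ?_, fun u _ v _ ha h => ?_⟩
  · exact Finset.mem_range.2 ((e v).2.trans_le hcard)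
  · exact ha.ne (e.injective (Fin.ext h))

/-- A clique that is properly contained in a larger connected set without cut-vertices lies on
cycles of many consecutive lengths. -/
theorem exists_cycles_of_cutVertexFree [Finite V] {G : SimpleGraph V} {k : ℕ} {W T : Set V}
    (hW : G.IsClique W) (hcard : W.ncard = k + 1) (hk : 2 ≤ k) (hWT : W ⊆ T) (hne : T ≠ W)
    (hT : CutVertexFree G T) : ∃ ℓ, ∀ i < k, HasCycleLength G (ℓ + i) := by
  classical
  obtain ⟨u, huT, huW⟩ := Set.not_subset.1 fun h => hne (h.antisymm hWT)
  obtain ⟨Q, hQ, huQ, hconn, hcl⟩ := exists_component G (S := T \ W) ⟨huT, huW⟩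
  have hQW : ∀ w ∈ W, w ∉ Q := fun w hw h => (hQ h).2 hw
  have hmem : ∀ q ∈ Q, ∀ w ∈ T, w ∉ Q → G.Adj q w → w ∈ W := fun q hq w hw hwQ ha =>
    by_contra fun h => hcl q hq w ⟨⟨hw, h⟩, hwQ⟩ ha
  obtain ⟨w₀, hw₀⟩ := Set.nonempty_of_ncard_ne_zero (s := W) (by omega)
  obtain ⟨q, ⟨-, hq⟩, x, ⟨hxT, hxQ⟩, hqx⟩ := exists_adj_of_preconnected hT.1.preconnected
    (A := Q) ⟨u, huT, huQ⟩ ⟨w₀, hWT hw₀, hQW w₀ hw₀⟩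
  have hxW := hmem q hq x hxT hxQ hqx
  obtain ⟨w₁, hw₁, hw₁x⟩ := Set.exists_ne_of_one_lt_ncard (s := W) (by omega) x
  obtain ⟨q', ⟨-, hq'⟩, y, ⟨⟨hyT, hyx⟩, hyQ⟩, hqy⟩ := exists_adj_of_preconnected (hT.2 x hxT)
    (A := Q) ⟨u, ⟨huT, fun h => huW (h ▸ hxW)⟩, huQ⟩ ⟨w₁, ⟨hWT hw₁, hw₁x⟩, hQW w₁ hw₁⟩
  have hyW := hmem q' hq' y hyT hyQ hqy
  obtain ⟨l, hl⟩ := hconn.exists_path hq (T := {v | G.Adj y v}) ⟨q', hqy.symm, hq'⟩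
  replace hl : IsPathList G Q {v | G.Adj x v} {v | G.Adj y v} l :=
    hl.mono subset_rfl (by rintro _ rfl; exact hqx.symm) subset_rfl
  set L := (W \ {x, y}).toFinite.toFinset.toList with hLdef
  have hL : L.Nodup := Finset.nodup_toList _
  have hLmem : ∀ v ∈ L, v ∈ W ∧ v ≠ x ∧ v ≠ y := fun v hv => by simpa [L] using hv
  have hLlen : L.length + 2 = k + 1 := by
    rw [hLdef, Finset.length_toList, ← Set.ncard_eq_toFinset_card, ← hcard,
      ← Set.ncard_pair (Ne.symm hyx), Set.ncard_sdiff_add_ncard_of_subset]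
    rintro z (rfl | rfl) <;> assumption
  refine ⟨l.length + 2, fun i hi => ?_⟩
  have hmW : ∀ v ∈ y :: (L.take i ++ [x]), v ∈ W := by
    intro v hv
    simp only [List.mem_cons, List.mem_append, List.not_mem_nil, or_false] at hv
    rcases hv with rfl | hv | rfl
    · exact hyW
    · exact (hLmem v (List.mem_of_mem_take hv)).1
    · exact hxW
  have hm : (y :: (L.take i ++ [x])).Nodup := by
    simp only [List.nodup_cons, List.mem_append, List.mem_singleton, not_or, List.nodup_append]
    refine ⟨⟨fun h => (hLmem y (List.mem_of_mem_take h)).2.2 rfl, hyx⟩,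
      hL.sublist (List.take_sublist _ _), by simp, ?_⟩
    rintro a ha b rfl rfl
    exact (hLmem _ (List.mem_of_mem_take ha)).2.1 rfl
  have hc : (y :: (L.take i ++ [x])).IsChain G.Adj :=
    (List.Pairwise.imp_of_mem (fun ha hb hne => hW (hmW _ ha) (hmW _ hb) hne) hm).isChain
  have := (hl.isCycleList hm hc rfl (by rw [← List.cons_append, List.getLast?_append]; simp)
    (fun v hv => hQW v (hmW v hv)) (by simp)).hasCycleLength
  convert this using 1
  simp
  omega

end ConsecutiveCycles

/-- Every graph of chromatic number `k + 1` (with `k ≥ 6`) either has a block isomorphic to the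
complete graph `K_{k+1}`, or contains `k` cycles of consecutive lengths. -/
theorem stmt_2 {V : Type*} [Fintype V] (k : ℕ) (hk : 6 ≤ k)
    (G : SimpleGraph V) (hchrom : G.chromaticNumber = k + 1) :
    (∃ S : Set V, IsBlock G S ∧ Nonempty (G.induce S ≃g SimpleGraph.completeGraph (Fin (k + 1)))) ∨
      (∃ ℓ : ℕ, ∀ i < k, HasCycleLength G (ℓ + i)) := by
  classical
  by_contra! hcon
  obtain ⟨hblock, hcyc⟩ := hcon
  have hcyc' : ¬ ∃ ℓ, ∀ i < k, HasCycleLength G (ℓ + i) := by push Not; exact hcyc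
  have hcol : G.Colorable (k + 1) := by
    rw [← SimpleGraph.chromaticNumber_le_iff_colorable, hchrom]; norm_cast
  have hncol : ¬ G.Colorable k := by
    rw [← SimpleGraph.chromaticNumber_le_iff_colorable, hchrom]
    norm_cast
    omega
  obtain ⟨W, hW, hlt⟩ := ConsecutiveCycles.exists_isClique_not_colorable hk hncol hcyc'
  have hcard : W.ncard = k + 1 := by
    refine le_antisymm ?_ hlt
    obtain ⟨f⟩ := hcol
    have h1 : Set.InjOn f W := fun u hu v hv h => by
      by_contra hne
      exact f.valid (hW hu hv hne) h
    have h2 := Set.ncard_le_ncard (Set.subset_univ (f '' W))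
    rw [h1.ncard_image, Set.ncard_univ, Nat.card_fin] at h2
    exact h2
  obtain ⟨w, hw⟩ := Set.nonempty_of_ncard_ne_zero (s := W) (by omega)
  have hfree : CutVertexFree G W :=
    ⟨{ preconnected := ConsecutiveCycles.preconnected_induce_of_isClique hW, nonempty := ⟨⟨w, hw⟩⟩ }, fun v _ =>
      ConsecutiveCycles.preconnected_induce_of_isClique (hW.subset Set.sdiff_subset)⟩
  refine (hblock W ⟨hfree, fun T hWT hT => ?_⟩).false ⟨Finite.equivFinOfCardEq
    (by rw [Nat.card_coe_set_eq, hcard]), fun {u v} => ?_⟩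
  · by_contra hne
    exact hcyc' (ConsecutiveCycles.exists_cycles_of_cutVertexFree hW hcard (by omega) hWT hne hT)
  · rw [SimpleGraph.completeGraph, SimpleGraph.top_adj, (Equiv.injective _).ne_iff]
    exact ⟨fun h => hW u.2 v.2 fun h' => h (Subtype.ext h'), fun h => h.ne⟩
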